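/- arXiv:1511.06588 — 3 statements merged into one kernel-verified Lean document; each statement's English description precedes it below -/
import Mathlib

section
/- Consider the transverse system ė = F(e,x), ẋ = G(e,x) and assume Property UES-TL holds, i.e. there exist k̃, λ̃ > 0 such that every solution (δE(δ₀,x₀,t), X̃(x₀,t)) of the transversally linearized system δė = (∂F/∂e)(0,x)δ, ẋ = G̃(x) := G(0,x) satisfies |δE(δ₀,x₀,t)| ≤ k̃ exp(−λ̃ t)|δ₀| for all (δ₀,x₀,t). Assume moreover there exists μ > 0 such that |∂F/∂e(0,x)| ≤ μ for all x in ℝ^{n_x}. Then for every symmetric positive definite matrix Q in ℝ^{n_e×n_e} there exist a continuous function P : ℝ^{n_x} → ℝ^{n_e×n_e} taking symmetric values and strictly positive real numbers p̲ and p̄ such that: (i) for every x the limit 𝔡_{G̃}P(x) := lim_{h→0} (P(X̃(x,h)) − P(x))/h exists; (ii) 𝔡_{G̃}P(x) + P(x)(∂F/∂e)(0,x) + (∂F/∂e)(0,x)ᵀP(x) ≤ −Q for all x (in the sense of symmetric matrices); and (iii) p̲ I ≤ P(x) ≤ p̄ I for all x. -/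
open Real Set Filter
open scoped RealInnerProductSpace Topology

/-- Euclidean state space ℝⁿ. -/
abbrev Euc (n : ℕ) := EuclideanSpace ℝ (Fin n)

open MeasureTheory

section ContinuousDependence

variable {E : Type*} [NormedAddCommGroup E] [NormedSpace ℝ E]

/-- A forward solution of the autonomous equation `ẏ = V y`. -/
def IsForwardSolution (V : E → E) (y : ℝ → E) : Prop :=
  ∀ t, 0 ≤ t → HasDerivWithinAt y (V (y t)) (Ici 0) t

lemma IsForwardSolution.continuousOn {V : E → E} {y : ℝ → E} (hy : IsForwardSolution V y) :
    ContinuousOn y (Ici 0) := fun t ht => (hy t ht).continuousWithinAt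

/-- Forward solutions of a `C¹` vector field depend continuously on their initial value. -/
lemma IsForwardSolution.exists_norm_sub_le [FiniteDimensional ℝ E] {V : E → E}
    (hV : ContDiff ℝ 1 V) {z : ℝ → E} (hz : IsForwardSolution V z) {T η : ℝ}
    (hT : 0 ≤ T) (hη : 0 < η) :
    ∃ ε > 0, ∀ y, IsForwardSolution V y → ‖y 0 - z 0‖ ≤ ε → ‖y T - z T‖ ≤ η := by
  obtain ⟨R, hR⟩ := isCompact_Icc.exists_bound_of_continuousOn
    (hz.continuousOn.mono (Icc_subset_Ici_self : Icc 0 T ⊆ Ici 0))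
  obtain ⟨K, hK⟩ := hV.contDiffOn.exists_lipschitzOnWith one_ne_zero
    (convex_closedBall (0 : E) (R + 1)) (isCompact_closedBall 0 (R + 1))
  set m := min 1 η
  have hm : 0 < m := lt_min one_pos hη
  set B : ℝ → ℝ := fun t => m * exp ((K + 1) * (t - T))
  have hBd : ∀ t, HasDerivAt B (m * (exp ((K + 1) * (t - T)) * ((K + 1) * 1))) t := fun t =>
    ((((hasDerivAt_id t).sub_const T).const_mul _).exp).const_mul m
  have hBpos : ∀ t, 0 < B t := fun t => mul_pos hm (exp_pos _)
  have hBm : ∀ t ≤ T, B t ≤ m := fun t ht => by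
    refine mul_le_of_le_one_right hm.le (exp_le_one_iff.2 ?_)
    exact mul_nonpos_of_nonneg_of_nonpos (by positivity) (by linarith)
  refine ⟨B 0, hBpos 0, fun y hy h0 => ?_⟩
  have key := image_norm_le_of_norm_deriv_right_lt_deriv_boundary'
    (f := fun t => y t - z t) (f' := fun t => V (y t) - V (z t)) (a := 0) (b := T) (B := B)
    ((hy.continuousOn.sub hz.continuousOn).mono Icc_subset_Ici_self)
    (fun t ht => ((hy t ht.1).sub (hz t ht.1)).mono (Ici_subset_Ici.2 ht.1))
    h0 (fun t _ => (hBd t).continuousAt.continuousWithinAt)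
    (fun t _ => (hBd t).hasDerivWithinAt) ?_
  · exact (key (right_mem_Icc.2 hT)).trans ((hBm T le_rfl).trans (min_le_right _ _))
  · intro t ht hB
    have hzt := hR t ⟨ht.1, ht.2.le⟩
    have h1 : ‖y t - z t‖ ≤ 1 := hB.le.trans ((hBm t ht.2.le).trans (min_le_left _ _))
    have hyt : ‖y t‖ ≤ R + 1 := by
      have := norm_add_le (y t - z t) (z t)
      rw [sub_add_cancel] at this
      linarith
    have := hK.norm_sub_le (mem_closedBall_zero_iff.2 hyt)
      (mem_closedBall_zero_iff.2 (by linarith : ‖z t‖ ≤ R + 1))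
    rw [hB] at this
    have hBt := hBpos t
    have hBeq : m * (exp ((K + 1) * (t - T)) * ((K + 1) * 1)) = K * B t + B t := by
      simp only [B]; ring
    rw [hBeq]
    linarith

lemma IsForwardSolution.eq_of_initial_eq [FiniteDimensional ℝ E] {V : E → E}
    (hV : ContDiff ℝ 1 V) {y z : ℝ → E} (hy : IsForwardSolution V y)
    (hz : IsForwardSolution V z) (h0 : y 0 = z 0) {t : ℝ} (ht : 0 ≤ t) : y t = z t := by
  rw [← sub_eq_zero, ← norm_le_zero_iff]
  refine le_of_forall_pos_le_add fun η hη => ?_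
  obtain ⟨ε, hε, h⟩ := hz.exists_norm_sub_le hV ht hη
  rw [zero_add]
  exact h y hy (by simpa [h0] using hε.le)

lemma continuous_flow [FiniteDimensional ℝ E] {V : E → E} (hV : ContDiff ℝ 1 V) {φ : E → ℝ → E}
    (hφ : ∀ x, IsForwardSolution V (φ x)) (h0 : ∀ x, φ x 0 = x) {t : ℝ} (ht : 0 ≤ t) :
    Continuous fun x => φ x t := by
  refine Metric.continuous_iff'.2 fun x η hη => ?_
  obtain ⟨ε, hε, h⟩ := (hφ x).exists_norm_sub_le hV ht (half_pos hη)
  filter_upwards [Metric.closedBall_mem_nhds x hε] with y hy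
  rw [dist_eq_norm]
  refine (h _ (hφ y) ?_).trans_lt (half_lt_self hη)
  rw [h0, h0, ← dist_eq_norm]
  exact hy

lemma IsForwardSolution.comp_add {V : E → E} {y : ℝ → E} (hy : IsForwardSolution V y)
    {h : ℝ} (hh : 0 ≤ h) : IsForwardSolution V fun s => y (s + h) := by
  intro t ht
  have h1 : HasDerivWithinAt (fun s => s + h) 1 (Ici 0) t :=
    (hasDerivWithinAt_id t _).add_const h
  have := (hy (t + h) (add_nonneg ht hh)).scomp t h1
    (fun s hs => add_nonneg (mem_Ici.1 hs) hh)
  simpa [Function.comp_def] using this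

end ContinuousDependence

section Lyapunov

variable {E : Type*} [NormedAddCommGroup E] [InnerProductSpace ℝ E]

/-- A quadratic form invariant under a fundamental matrix up to an integral term satisfies the
Lyapunov differential equation. -/
lemma hasDerivWithinAt_of_star_mul_mul_eq [FiniteDimensional ℝ E]
    {Φ p J : ℝ → E →L[ℝ] E} {A P Q : E →L[ℝ] E}
    (hΦ : HasDerivWithinAt Φ A (Ici 0) 0) (hΦ0 : Φ 0 = 1)
    (hJ : HasDerivWithinAt J Q (Ici 0) 0) (hJ0 : J 0 = 0)
    (h : ∀ t, 0 ≤ t → star (Φ t) * p t * Φ t = P - J t) :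
    HasDerivWithinAt p (-(star A * P) - P * A - Q) (Ici 0) 0 := by
  have hinv : HasDerivWithinAt (fun t => Ring.inverse (Φ t)) (-A) (Ici 0) 0 := by
    have h1 : HasFDerivAt Ring.inverse
        (-ContinuousLinearMap.mulLeftRight ℝ (E →L[ℝ] E) 1 1) (Φ 0) := by
      rw [hΦ0]
      simpa using hasFDerivAt_ringInverse (𝕜 := ℝ) (1 : (E →L[ℝ] E)ˣ)
    simpa [Function.comp_def] using h1.comp_hasDerivWithinAt 0 hΦ
  have hprod := (hinv.star.mul ((hasDerivWithinAt_const (0 : ℝ) (Ici 0) P).sub hJ)).mul hinv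
  have hunit : ∀ᶠ t in 𝓝[Ici 0] (0 : ℝ), IsUnit (Φ t) := by
    refine hΦ.continuousWithinAt.eventually (Units.isOpen.mem_nhds ?_)
    rw [hΦ0]
    exact isUnit_one
  have heq : ∀ t, 0 ≤ t → IsUnit (Φ t) →
      p t = star (Ring.inverse (Φ t)) * (P - J t) * Ring.inverse (Φ t) := by
    intro t ht hu
    have h1 := Ring.mul_inverse_cancel _ hu
    have h2 : star (Ring.inverse (Φ t)) * star (Φ t) = 1 := by
      rw [← star_mul, h1, star_one]
    rw [← h t ht, mul_assoc, mul_assoc, mul_assoc, h1, mul_one, ← mul_assoc, h2, one_mul]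
  refine HasDerivWithinAt.congr_of_eventuallyEq (HasDerivWithinAt.congr_deriv hprod ?_) ?_
    (heq 0 le_rfl (by rw [hΦ0]; exact isUnit_one))
  · simp [hΦ0, hJ0]
    abel
  · filter_upwards [hunit, self_mem_nhdsWithin] with t hu ht using heq t ht hu

lemma integral_Ioi_zero_comp_add_right {F : Type*} [NormedAddCommGroup F] [NormedSpace ℝ F]
    (f : ℝ → F) (h : ℝ) : ∫ s in Ioi 0, f (s + h) = ∫ s in Ioi h, f s := by
  have := (measurePreserving_add_right (volume : Measure ℝ) h).setIntegral_preimage_emb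
    (measurableEmbedding_addRight h) f (Ioi h)
  simpa using this

lemma exists_pos_mul_norm_sq_le_inner [FiniteDimensional ℝ E] (Q : E →L[ℝ] E)
    (hQ : ∀ v, v ≠ 0 → 0 < ⟪Q v, v⟫) :
    ∃ q > 0, ∀ v, q * ‖v‖ ^ 2 ≤ ⟪Q v, v⟫ := by
  rcases subsingleton_or_nontrivial E with hE | hE
  · exact ⟨1, one_pos, fun v => by simp [Subsingleton.elim v 0]⟩
  obtain ⟨u, hu, hmin⟩ := (isCompact_sphere (0 : E) 1).exists_isMinOn
    (NormedSpace.sphere_nonempty.2 zero_le_one)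
    (f := fun v => ⟪Q v, v⟫) (by fun_prop)
  have hu0 : u ≠ 0 := ne_zero_of_mem_unit_sphere ⟨u, hu⟩
  refine ⟨⟪Q u, u⟫, hQ u hu0, fun v => ?_⟩
  rcases eq_or_ne v 0 with rfl | hv
  · simp
  have hv' : ‖v‖ ≠ 0 := norm_ne_zero_iff.2 hv
  have := hmin (show ‖v‖⁻¹ • v ∈ Metric.sphere (0 : E) 1 by simp [norm_smul, hv'])
  simp only [mem_ofPred_eq, map_smul, inner_smul_left, inner_smul_right] at this
  calc ⟪Q u, u⟫ * ‖v‖ ^ 2 ≤ _ := mul_le_mul_of_nonneg_right this (sq_nonneg _)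
    _ = ⟪Q v, v⟫ := by simp; field_simp

/-- An exponentially decaying trajectory whose logarithmic rate is bounded by `μ` has square
integral bounded below. -/
lemma norm_sq_le_integral_norm_sq {w w' : ℝ → E}
    (hw : ∀ t, 0 ≤ t → HasDerivWithinAt w (w' t) (Ici 0) t) (hw' : ContinuousOn w' (Ici 0))
    {c k μ : ℝ} (hk : 0 < k) (hdecay : ∀ t, 0 ≤ t → ‖w t‖ ^ 2 ≤ c * exp (-k * t))
    (hrate : ∀ t, 0 ≤ t → ‖w' t‖ ≤ μ * ‖w t‖) :
    ‖w 0‖ ^ 2 ≤ 2 * μ * ∫ t in Ioi 0, ‖w t‖ ^ 2 := by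
  have hwc : ContinuousOn w (Ici 0) := fun t ht => (hw t ht).continuousWithinAt
  have hexp : IntegrableOn (fun t => c * exp (-k * t)) (Ioi 0) :=
    (exp_neg_integrableOn_Ioi 0 hk).const_mul c
  have hsq : IntegrableOn (fun t => ‖w t‖ ^ 2) (Ioi 0) := by
    refine Integrable.mono' hexp (((hwc.norm.pow 2).mono
      Ioi_subset_Ici_self).aestronglyMeasurable measurableSet_Ioi) ?_
    filter_upwards [ae_restrict_mem measurableSet_Ioi] with t ht
    simpa using hdecay t (le_of_lt ht)
  have hbd : ∀ t, 0 ≤ t → |2 * ⟪w t, w' t⟫| ≤ 2 * μ * ‖w t‖ ^ 2 := fun t ht => by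
    rw [abs_mul, abs_two]
    have := (abs_real_inner_le_norm (w t) (w' t)).trans
      (mul_le_mul_of_nonneg_left (hrate t ht) (norm_nonneg _))
    nlinarith
  have hint : IntegrableOn (fun t => 2 * ⟪w t, w' t⟫) (Ioi 0) := by
    refine Integrable.mono' (hsq.const_mul (2 * μ)) (((continuousOn_const.mul
      (hwc.inner hw')).mono Ioi_subset_Ici_self).aestronglyMeasurable measurableSet_Ioi) ?_
    filter_upwards [ae_restrict_mem measurableSet_Ioi] with t ht
    exact hbd t (le_of_lt ht)
  have hlim : Tendsto (fun t => ‖w t‖ ^ 2) atTop (𝓝 0) := by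
    refine squeeze_zero' (Eventually.of_forall fun t => sq_nonneg _)
      ((eventually_ge_atTop 0).mono fun t ht => hdecay t ht) ?_
    have : Tendsto (fun t => exp (-k * t)) atTop (𝓝 0) := by
      refine tendsto_exp_atBot.comp ?_
      exact tendsto_id.const_mul_atTop_of_neg (by linarith)
    simpa using this.const_mul c
  have hftc := integral_Ioi_of_hasDerivAt_of_tendsto (a := 0) (f := fun t => ‖w t‖ ^ 2)
    ((hwc.norm.pow 2) 0 self_mem_Ici)
    (fun t ht => ((hw t (le_of_lt ht)).hasDerivAt (Ici_mem_nhds ht)).norm_sq) hint hlim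
  have hmono : ∫ t in Ioi 0, -(2 * ⟪w t, w' t⟫) ≤ ∫ t in Ioi 0, 2 * μ * ‖w t‖ ^ 2 :=
    setIntegral_mono_on hint.neg (hsq.const_mul _) measurableSet_Ioi
      fun t ht => (neg_le_abs _).trans (hbd t (le_of_lt ht))
  rw [integral_neg, hftc, integral_const_mul] at hmono
  linarith

/-- Converse Lyapunov theorem for an exponentially stable linear cocycle over a semiflow. -/
theorem exists_lyapunov_of_cocycle [FiniteDimensional ℝ E] {X : Type*}
    [TopologicalSpace X] [FirstCountableTopology X]
    {φ : X → ℝ → X} {A : X → E →L[ℝ] E} {Φ : X → ℝ → E →L[ℝ] E} {k c μ : ℝ}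
    (hφ0 : ∀ x, φ x 0 = x)
    (hΦ0 : ∀ x, Φ x 0 = 1)
    (hΦ : ∀ x t, 0 ≤ t → HasDerivWithinAt (Φ x) (A (φ x t) * Φ x t) (Ici 0) t)
    (hcocycle : ∀ x h s, 0 ≤ h → 0 ≤ s → Φ (φ x h) s * Φ x h = Φ x (s + h))
    (hΦc : ∀ t, 0 ≤ t → Continuous fun x => Φ x t)
    (hAc : ∀ x, ContinuousOn (fun t => A (φ x t)) (Ici 0))
    (hc : 0 < c) (hdecay : ∀ x t, 0 ≤ t → ‖Φ x t‖ ≤ k * exp (-c * t))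
    (hμ : 0 < μ) (hA : ∀ x, ‖A x‖ ≤ μ)
    {Q : E →L[ℝ] E} (hQ : IsSelfAdjoint Q) (hQpos : ∀ v, v ≠ 0 → 0 < ⟪Q v, v⟫) :
    ∃ (P : X → E →L[ℝ] E) (pl pu : ℝ), Continuous P ∧ (∀ x, IsSelfAdjoint (P x)) ∧
      0 < pl ∧ 0 < pu ∧
      (∀ x, HasDerivWithinAt (fun h => P (φ x h)) (-(star (A x) * P x) - P x * A x - Q)
        (Ici 0) 0) ∧
      ∀ x v, pl * ‖v‖ ^ 2 ≤ ⟪P x v, v⟫ ∧ ⟪P x v, v⟫ ≤ pu * ‖v‖ ^ 2 := by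
  obtain ⟨q, hq, hqQ⟩ := exists_pos_mul_norm_sq_le_inner Q hQpos
  have hΦt : ∀ x, ContinuousOn (Φ x) (Ici 0) := fun x t ht => (hΦ x t ht).continuousWithinAt
  set M : X → ℝ → E →L[ℝ] E := fun x s => star (Φ x (max s 0)) * Q * Φ x (max s 0) with hMdef
  have hM : ∀ x s, 0 ≤ s → M x s = star (Φ x s) * Q * Φ x s := fun x s hs => by
    simp only [hMdef, max_eq_left hs]
  have hMt : ∀ x, Continuous (M x) := fun x => by
    have h1 : Continuous fun s : ℝ => Φ x (max s 0) :=
      (hΦt x).comp_continuous (by fun_prop) fun s => mem_Ici.2 (le_max_right s 0)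
    exact (h1.star.mul continuous_const).mul h1
  have hMx : ∀ s, Continuous fun x => M x s := fun s =>
    ((hΦc _ (le_max_right s 0)).star.mul continuous_const).mul (hΦc _ (le_max_right s 0))
  set b : ℝ → ℝ := fun s => k ^ 2 * ‖Q‖ * exp (-(2 * c) * s)
  have hsq : ∀ x s, 0 ≤ s → ‖Φ x s‖ ^ 2 ≤ k ^ 2 * exp (-(2 * c) * s) := fun x s hs => by
    calc ‖Φ x s‖ ^ 2 ≤ (k * exp (-c * s)) ^ 2 :=
          pow_le_pow_left₀ (norm_nonneg _) (hdecay x s hs) 2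
      _ = k ^ 2 * exp (-(2 * c) * s) := by
          rw [mul_pow, ← exp_nat_mul]; congr 2; push_cast; ring
  have hMb : ∀ x s, 0 ≤ s → ‖M x s‖ ≤ b s := fun x s hs => by
    rw [hM x s hs]
    calc ‖star (Φ x s) * Q * Φ x s‖ ≤ ‖star (Φ x s)‖ * ‖Q‖ * ‖Φ x s‖ := norm_mul₃_le
      _ = ‖Φ x s‖ ^ 2 * ‖Q‖ := by
          rw [show ‖star (Φ x s)‖ = ‖Φ x s‖ from
            ContinuousLinearMap.adjoint.norm_map (Φ x s)]; ring
      _ ≤ k ^ 2 * exp (-(2 * c) * s) * ‖Q‖ :=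
          mul_le_mul_of_nonneg_right (hsq x s hs) (norm_nonneg _)
      _ = b s := by simp only [b]; ring
  have hbint : IntegrableOn b (Ioi 0) :=
    (exp_neg_integrableOn_Ioi 0 (by positivity)).const_mul _
  have hMae : ∀ x, ∀ᵐ s ∂(volume.restrict (Ioi (0 : ℝ))), ‖M x s‖ ≤ b s := fun x => by
    filter_upwards [ae_restrict_mem measurableSet_Ioi] with s hs using hMb x s (le_of_lt hs)
  have hMint : ∀ x, IntegrableOn (M x) (Ioi 0) := fun x =>
    hbint.mono' (hMt x).aestronglyMeasurable (hMae x)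
  set P : X → E →L[ℝ] E := fun x => ∫ s in Ioi 0, M x s
  have hPnorm : ∀ x, ‖P x‖ ≤ ∫ s in Ioi 0, b s := fun x =>
    norm_integral_le_of_norm_le hbint (hMae x)
  have hb0 : 0 ≤ ∫ s in Ioi 0, b s := integral_nonneg fun s => by positivity
  have hPinner : ∀ x v, ⟪P x v, v⟫ = ∫ s in Ioi 0, ⟪Q (Φ x s v), Φ x s v⟫ := fun x v => by
    have h1 : P x v = ∫ s in Ioi 0, M x s v := ContinuousLinearMap.integral_apply (hMint x) v
    rw [real_inner_comm, h1, ← integral_inner ((hMint x).apply_continuousLinearMap v)]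
    refine setIntegral_congr_fun measurableSet_Ioi fun s hs => ?_
    simp only [hM x s (le_of_lt hs), ContinuousLinearMap.star_eq_adjoint,
      mul_apply_eq_comp, ContinuousLinearMap.adjoint_inner_right]
    rw [real_inner_comm]
  refine ⟨P, q / (2 * μ), (∫ s in Ioi 0, b s) + 1, ?_, ?_, by positivity, by positivity, ?_, ?_⟩
  · exact continuous_of_dominated (fun x => (hMt x).aestronglyMeasurable) hMae hbint
      (Eventually.of_forall hMx)
  · intro x
    have h1 : ∀ s, star (M x s) = M x s := fun s => by
      simp [hMdef, hQ.star_eq, mul_assoc]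
    have h2 := ((starL' ℝ : (E →L[ℝ] E) ≃L[ℝ] (E →L[ℝ] E)) :
      (E →L[ℝ] E) →L[ℝ] (E →L[ℝ] E)).integral_comp_comm (hMint x)
    have h3 : star (∫ s in Ioi 0, M x s) = ∫ s in Ioi 0, M x s := by
      simpa [h1] using h2.symm
    exact h3
  · intro x
    have hd := hΦ x 0 le_rfl
    rw [hφ0, hΦ0, mul_one] at hd
    have hJ : HasDerivWithinAt (fun h => ∫ s in (0 : ℝ)..h, M x s) Q (Ici 0) 0 := by
      have := intervalIntegral.integral_hasDerivAt_right (a := 0) (b := 0)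
        ((hMt x).intervalIntegrable _ _) ((hMt x).stronglyMeasurableAtFilter _ _)
        (hMt x).continuousAt
      simpa [hMdef, hΦ0] using this.hasDerivWithinAt
    refine hasDerivWithinAt_of_star_mul_mul_eq hd (hΦ0 x) hJ (by simp) fun h hh => ?_
    have h1 : star (Φ x h) * P (φ x h) * Φ x h
        = ∫ s in Ioi 0, star (Φ x h) * M (φ x h) s * Φ x h := by
      rw [integral_mul_const_of_integrable ((hMint _).const_mul _),
        integral_const_mul_of_integrable (hMint _)]
    have h2 : ∫ s in Ioi 0, star (Φ x h) * M (φ x h) s * Φ x h = ∫ s in Ioi 0, M x (s + h) := by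
      refine setIntegral_congr_fun measurableSet_Ioi fun s hs => ?_
      have hs' : 0 ≤ s := le_of_lt hs
      simp only [hM _ s hs', hM _ (s + h) (add_nonneg hs' hh), ← hcocycle x h s hh hs', star_mul,
        mul_assoc]
    rw [h1, h2, integral_Ioi_zero_comp_add_right, eq_sub_iff_add_eq']
    exact intervalIntegral.integral_interval_add_Ioi (hMint x)
      ((hMint x).mono_set (Ioi_subset_Ioi hh))
  · intro x v
    constructor
    · have hwd : ∀ t, 0 ≤ t → HasDerivWithinAt (fun t => Φ x t v) (A (φ x t) (Φ x t v))
          (Ici 0) t := fun t ht => by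
        simpa using (hΦ x t ht).clm_apply (hasDerivWithinAt_const t (Ici 0) v)
      have hwc : ContinuousOn (fun t => Φ x t v) (Ici 0) := (hΦt x).clm_apply continuousOn_const
      have hwb : ∀ t, 0 ≤ t → ‖Φ x t v‖ ^ 2 ≤ k ^ 2 * ‖v‖ ^ 2 * exp (-(2 * c) * t) :=
        fun t ht => by
          have h1 := pow_le_pow_left₀ (norm_nonneg _) ((Φ x t).le_opNorm v) 2
          have h2 := mul_le_mul_of_nonneg_right (hsq x t ht) (sq_nonneg ‖v‖)
          rw [mul_pow] at h1
          linarith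
      have hlow := norm_sq_le_integral_norm_sq hwd ((hAc x).clm_apply hwc)
        (by positivity : 0 < 2 * c) hwb
        (fun t _ => (A (φ x t)).le_of_opNorm_le (hA _) _)
      have hnorm_int : IntegrableOn (fun t => ‖Φ x t v‖ ^ 2) (Ioi 0) := by
        refine Integrable.mono' ((exp_neg_integrableOn_Ioi 0
          (by positivity : 0 < 2 * c)).const_mul (k ^ 2 * ‖v‖ ^ 2)) (((hwc.norm.pow 2).mono
            Ioi_subset_Ici_self).aestronglyMeasurable measurableSet_Ioi) ?_
        filter_upwards [ae_restrict_mem measurableSet_Ioi] with t ht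
        simpa using hwb t (le_of_lt ht)
      have hQint : IntegrableOn (fun t => ⟪Q (Φ x t v), Φ x t v⟫) (Ioi 0) := by
        refine Integrable.mono' (hnorm_int.const_mul ‖Q‖) ((((Q.continuous.comp_continuousOn
          hwc).inner hwc).mono Ioi_subset_Ici_self).aestronglyMeasurable measurableSet_Ioi)
          (Eventually.of_forall fun t => ?_)
        refine (norm_inner_le_norm _ _).trans ?_
        rw [pow_two, ← mul_assoc]
        exact mul_le_mul_of_nonneg_right (Q.le_opNorm _) (norm_nonneg _)
      have hmono : ∫ t in Ioi 0, q * ‖Φ x t v‖ ^ 2 ≤ ∫ t in Ioi 0, ⟪Q (Φ x t v), Φ x t v⟫ :=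
        integral_mono (hnorm_int.const_mul q) hQint fun t => hqQ _
      rw [integral_const_mul] at hmono
      rw [hPinner]
      refine le_trans ?_ hmono
      rw [hΦ0, one_apply_eq_self] at hlow
      calc q / (2 * μ) * ‖v‖ ^ 2
          ≤ q / (2 * μ) * (2 * μ * ∫ t in Ioi 0, ‖Φ x t v‖ ^ 2) :=
            mul_le_mul_of_nonneg_left hlow (by positivity)
        _ = q * ∫ t in Ioi 0, ‖Φ x t v‖ ^ 2 := by field_simp
    · have h1 := real_inner_le_norm (P x v) v
      have h2 := (P x).le_of_opNorm_le (hPnorm x) v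
      nlinarith [norm_nonneg v, sq_nonneg ‖v‖]

end Lyapunov

/-- **Fact 2 for transverse exponential stability** (Proposition 2):
Assume Property UES-TL holds for the transversally linearized system
δė = ∂F/∂e(0,x) δ, ẋ = G̃(x) := G(0,x) (with flow (δE, X̃)), i.e. there are
k̃, λ̃ > 0 with |δE(δ₀,x₀,t)| ≤ k̃ exp(−λ̃ t)|δ₀| for all δ₀, x₀, t ≥ 0, and assume
|∂F/∂e(0,x)| ≤ μ for all x. Then for every symmetric positive definite Q there are
a continuous symmetric-matrix-valued P and 0 < p̲, p̄ such that P has a derivative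
𝔡_{G̃}P(x) along G̃ satisfying
𝔡_{G̃}P(x) + P(x) ∂F/∂e(0,x) + ∂F/∂e(0,x)ᵀ P(x) ≤ −Q and p̲ I ≤ P(x) ≤ p̄ I. -/
theorem fact2_transverse_local
    {ne nx : ℕ}
    (F : Euc ne × Euc nx → Euc ne) (G : Euc ne × Euc nx → Euc nx)
    (hF : ContDiff ℝ 2 F) (hG : ContDiff ℝ 2 G)
    (hF0 : ∀ x, F (0, x) = 0)
    (dFe : Euc ne → Euc nx → Euc ne →L[ℝ] Euc ne)
    (hdFe : ∀ e x, HasFDerivAt (fun e' => F (e', x)) (dFe e x) e)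
    -- flow X̃ of ẋ = G̃(x) := G(0,x)
    (Xt : Euc nx → ℝ → Euc nx)
    (hXt0 : ∀ x, Xt x 0 = x)
    (hXt : ∀ x t, 0 ≤ t → HasDerivWithinAt (Xt x) (G (0, Xt x t)) (Ici 0) t)
    -- flow δE of δė = ∂F/∂e(0, X̃(x,t)) δ
    (δE : Euc ne → Euc nx → ℝ → Euc ne)
    (hδE0 : ∀ δ x, δE δ x 0 = δ)
    (hδE : ∀ δ x t, 0 ≤ t →
      HasDerivWithinAt (δE δ x) (dFe 0 (Xt x t) (δE δ x t)) (Ici 0) t)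
    -- Property UES-TL
    (kt lamt : ℝ) (hkt : 0 < kt) (hlamt : 0 < lamt)
    (hUES : ∀ δ x t, 0 ≤ t → ‖δE δ x t‖ ≤ kt * exp (-lamt * t) * ‖δ‖)
    -- bound on ∂F/∂e(0,·)
    (μ : ℝ) (hμ : 0 < μ) (hbnd : ∀ x, ‖dFe 0 x‖ ≤ μ) :
    ∀ Q : Euc ne →L[ℝ] Euc ne, IsSelfAdjoint Q → (∀ v, v ≠ 0 → 0 < ⟪Q v, v⟫) →
      ∃ (P : Euc nx → Euc ne →L[ℝ] Euc ne) (dP : Euc nx → Euc ne →L[ℝ] Euc ne)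
        (pl pu : ℝ),
        Continuous P ∧ (∀ x, IsSelfAdjoint (P x)) ∧ 0 < pl ∧ 0 < pu ∧
        -- (i) the derivative of P along G̃ exists
        (∀ x, HasDerivWithinAt (fun h => P (Xt x h)) (dP x) (Ici 0) 0) ∧
        -- (ii) the Lyapunov matrix inequality
        (∀ x v, ⟪(dP x + P x ∘L dFe 0 x +
            ContinuousLinearMap.adjoint (dFe 0 x) ∘L P x) v, v⟫ ≤ -⟪Q v, v⟫) ∧
        -- (iii) p̲ I ≤ P(x) ≤ p̄ I
        (∀ x v, pl * ‖v‖ ^ 2 ≤ ⟪P x v, v⟫ ∧ ⟪P x v, v⟫ ≤ pu * ‖v‖ ^ 2) := by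
  intro Q hQ hQpos
  set A : Euc nx → Euc ne →L[ℝ] Euc ne := dFe 0
  have hAeq : ∀ x, A x =
      (fderiv ℝ F (0, x)).comp (ContinuousLinearMap.inl ℝ (Euc ne) (Euc nx)) := by
    intro x
    have h1 : HasFDerivAt F (fderiv ℝ F (0, x)) ((fun e' => (e', x)) (0 : Euc ne)) :=
      (hF.differentiable two_ne_zero (0, x)).hasFDerivAt
    exact (hdFe 0 x).unique (h1.comp 0 (hasFDerivAt_prodMk_left 0 x))
  have hA : ContDiff ℝ 1 A := by
    have h1 : ContDiff ℝ 1 (fderiv ℝ F) := hF.fderiv_right (by norm_num)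
    have h2 : ContDiff ℝ 1 fun x : Euc nx => fderiv ℝ F (0, x) :=
      h1.comp (contDiff_const.prodMk contDiff_id)
    rw [show A = _ from funext hAeq]
    exact h2.clm_comp contDiff_const
  set V : Euc ne × Euc nx → Euc ne × Euc nx := fun p => (A p.2 p.1, G (0, p.2))
  have hV : ContDiff ℝ 1 V :=
    ((hA.comp contDiff_snd).clm_apply contDiff_fst).prodMk
      ((hG.of_le one_le_two).comp (contDiff_const.prodMk contDiff_snd))
  have hsol : ∀ δ x, IsForwardSolution V fun t => (δE δ x t, Xt x t) := fun δ x t ht =>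
    (hδE δ x t ht).prodMk (hXt x t ht)
  have hXc : ∀ x, ContinuousOn (Xt x) (Ici 0) := fun x t ht => (hXt x t ht).continuousWithinAt
  have hδc : ∀ δ t, 0 ≤ t → Continuous fun x => δE δ x t := fun δ t ht => by
    have h1 := continuous_flow hV (φ := fun p t => (δE p.1 p.2 t, Xt p.2 t))
      (fun p => hsol p.1 p.2) (fun p => by simp [hδE0, hXt0]) ht
    exact continuous_fst.comp (h1.comp (Continuous.prodMk_right δ))
  set e := EuclideanSpace.basisFun (Fin ne) ℝ
  set Φ : Euc nx → ℝ → Euc ne →L[ℝ] Euc ne := fun x t =>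
    ∑ i, (EuclideanSpace.proj i : Euc ne →L[ℝ] ℝ).smulRight (δE (e i) x t)
  have hΦapp : ∀ x t v, Φ x t v = ∑ i, v i • δE (e i) x t := fun x t v => by
    simp [Φ]
  have hΦd : ∀ x t, 0 ≤ t → HasDerivWithinAt (Φ x) (A (Xt x t) * Φ x t) (Ici 0) t := by
    intro x t ht
    have h1 : HasDerivWithinAt (Φ x) (∑ i, (EuclideanSpace.proj i : Euc ne →L[ℝ] ℝ).smulRight
        (A (Xt x t) (δE (e i) x t))) (Ici 0) t :=
      HasDerivWithinAt.fun_sum fun i _ =>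
        ((ContinuousLinearMap.smulRightL ℝ (Euc ne) (Euc ne)
          (EuclideanSpace.proj i : Euc ne →L[ℝ] ℝ)).hasFDerivAt.comp_hasDerivWithinAt t
            (hδE (e i) x t ht))
    refine h1.congr_deriv ?_
    ext1 v
    simp [hΦapp]
  have hΦ0 : ∀ x, Φ x 0 = 1 := fun x => by
    ext1 v
    rw [hΦapp]
    simp only [hδE0]
    exact e.sum_repr v
  have hΦδ : ∀ x t, 0 ≤ t → ∀ v, Φ x t v = δE v x t := by
    intro x t ht v
    have hs : IsForwardSolution V fun t => (Φ x t v, Xt x t) := fun t ht =>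
      HasDerivWithinAt.prodMk
        (by simpa using (hΦd x t ht).clm_apply (hasDerivWithinAt_const t (Ici 0) v)) (hXt x t ht)
    exact congrArg Prod.fst (hs.eq_of_initial_eq hV (hsol v x) (by simp [hΦ0, hδE0]) ht)
  obtain ⟨P, pl, pu, hPc, hPs, hpl, hpu, hPd, hPb⟩ := exists_lyapunov_of_cocycle (φ := Xt)
    (A := A) (Φ := Φ) (k := kt) (c := lamt) (μ := μ) hXt0 hΦ0 hΦd
    (fun x h s hh hs => by
      ext1 v
      rw [mul_apply_eq_comp, hΦδ _ h hh, hΦδ _ s hs, hΦδ _ _ (add_nonneg hs hh)]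
      exact congrArg Prod.fst ((hsol (δE v x h) (Xt x h)).eq_of_initial_eq hV
        ((hsol v x).comp_add hh) (by simp [hδE0, hXt0]) hs))
    (fun t ht => continuous_finsetSum _ fun i _ =>
      (ContinuousLinearMap.smulRightL ℝ (Euc ne) (Euc ne)
        (EuclideanSpace.proj i : Euc ne →L[ℝ] ℝ)).continuous.comp (hδc (e i) t ht))
    (fun x => hA.continuous.comp_continuousOn (hXc x)) hlamt
    (fun x t ht => ContinuousLinearMap.opNorm_le_bound _ (by positivity) fun v => by
      rw [hΦδ x t ht]; exact hUES v x t ht)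
    hμ hbnd hQ hQpos
  refine ⟨P, _, pl, pu, hPc, hPs, hpl, hpu, hPd, fun x v => le_of_eq ?_, hPb⟩
  simp only [ContinuousLinearMap.star_eq_adjoint, ← ContinuousLinearMap.mul_def]
  rw [← inner_neg_left, ← neg_apply]
  congr 2
  abel
end

section
/- Let F : ℝ^{n} → ℝ^{n} be C¹ with F(0) = 0, with forward-complete flow E(e,t), and let Φ(e,t) be the associated transition matrix. Assume there exist continuous strictly increasing functions k, k̃ : ℝ₊ → ℝ₊ and positive real numbers λ, λ̃ such that |E(e,t)| ≤ k(|e|) exp(−λ t)|e| and |Φ(e,t)δ| ≤ k̃(|e|) exp(−λ̃ t)|δ| for all e, δ and t ≥ 0. Let Q be a symmetric positive definite matrix. Then the matrix function P(e) := lim_{T→∞} ∫₀ᵀ Φ(e,s)ᵀ Q Φ(e,s) ds is well defined and continuous on ℝ^{n}, and there exist a positive non-increasing function p̲ and a non-decreasing function p̄ such that 0 < p̲(|e|) I ≤ P(e) ≤ p̄(|e|) I for all e. Moreover, for every e the limit 𝔡_F P(e) := lim_{h→0} (P(E(e,h)) − P(e))/h exists and satisfies 𝔡_F P(e) + P(e)(∂F/∂e)(e)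 + (∂F/∂e)(e)ᵀ P(e) ≤ −Q for all e in ℝ^{n}. Finally, if F is C³ then P is C². -/
open Real Set Filter
open scoped RealInnerProductSpace Topology

/-- A forward-complete flow `f` of `G` with transition matrix `T`, both decaying exponentially,
uniformly over initial conditions in bounded sets. -/
structure DecayingFlow {X : Type*} [NormedAddCommGroup X] [NormedSpace ℝ X]
    (G : X → X) (f : X → ℝ → X) (T : X → ℝ → X →L[ℝ] X) : Prop where
  contDiff : ContDiff ℝ 1 G
  init : ∀ x, f x 0 = x
  flow : ∀ x t, 0 ≤ t → HasDerivWithinAt (f x) (G (f x t)) (Ici 0) t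
  trans_init : ∀ x, T x 0 = ContinuousLinearMap.id ℝ X
  trans : ∀ x t, 0 ≤ t → HasDerivWithinAt (T x) ((fderiv ℝ G (f x t)) ∘L T x t) (Ici 0) t
  decay : ∃ l : ℝ, 0 < l ∧ ∀ R : ℝ, ∃ C : ℝ, 0 < C ∧ ∀ x, ‖x‖ ≤ R → ∀ t, 0 ≤ t →
    ‖f x t‖ ≤ C * exp (-l * t) ∧ ‖T x t‖ ≤ C * exp (-l * t)

lemma norm_le_of_norm_deriv_le {E : Type*} [NormedAddCommGroup E] [NormedSpace ℝ E]
    {z z' : ℝ → E} {δ K ε t : ℝ} (hK : 0 < K) (hε : 0 ≤ ε) (ht : 0 ≤ t)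
    (hz : ∀ s, 0 ≤ s → HasDerivWithinAt z (z' s) (Ici 0) s) (h0 : ‖z 0‖ ≤ δ)
    (hb : ∀ s ∈ Icc 0 t, ‖z' s‖ ≤ K * ‖z s‖ + ε) :
    ‖z t‖ ≤ (δ + ε / K) * exp (K * t) := by
  have h := norm_le_gronwallBound_of_norm_deriv_right_le (a := 0) (b := t)
    (fun s hs => ((hz s hs.1).continuousWithinAt).mono Icc_subset_Ici_self)
    (fun s hs => (hz s hs.1).mono (Ici_subset_Ici.2 hs.1)) h0
    (fun s hs => hb s (Ico_subset_Icc_self hs)) t ⟨ht, le_rfl⟩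
  rw [gronwallBound_of_K_ne_0 hK.ne', sub_zero] at h
  have : 0 ≤ ε / K := by positivity
  linarith

lemma hasDerivWithinAt_const_add {E : Type*} [NormedAddCommGroup E] [NormedSpace ℝ E]
    {z : ℝ → E} {z' : E} {s t : ℝ} (hs : 0 ≤ s) (h : HasDerivWithinAt z z' (Ici 0) (s + t)) :
    HasDerivWithinAt (fun t => z (s + t)) z' (Ici 0) t := by
  simpa [Function.comp_def] using HasDerivWithinAt.scomp (h := fun t => s + t) t h
    ((hasDerivWithinAt_id t (Ici 0)).const_add s) (fun q hq => add_nonneg hs hq)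

lemma eq_of_norm_deriv_sub_le {E : Type*} [NormedAddCommGroup E] [NormedSpace ℝ E]
    {z w z' w' : ℝ → E} {K t : ℝ} (hK : 0 < K) (ht : 0 ≤ t)
    (hz : ∀ s, 0 ≤ s → HasDerivWithinAt z (z' s) (Ici 0) s)
    (hw : ∀ s, 0 ≤ s → HasDerivWithinAt w (w' s) (Ici 0) s) (h0 : z 0 = w 0)
    (hb : ∀ s ∈ Icc 0 t, ‖z' s - w' s‖ ≤ K * ‖z s - w s‖) : z t = w t := by
  have h := norm_le_of_norm_deriv_le (z := fun s => z s - w s) (δ := 0) hK le_rfl ht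
    (fun s hs => (hz s hs).sub (hw s hs)) (by simp [h0]) (fun s hs => by simpa using hb s hs)
  simpa [sub_eq_zero] using h

namespace DecayingFlow

variable {X : Type*} [NormedAddCommGroup X] [NormedSpace ℝ X]
  {G : X → X} {f : X → ℝ → X} {T : X → ℝ → X →L[ℝ] X}

lemma continuous_fderiv (H : DecayingFlow G f T) : Continuous (fderiv ℝ G) :=
  H.contDiff.continuous_fderiv one_ne_zero

lemma differentiable (H : DecayingFlow G f T) : Differentiable ℝ G :=
  H.contDiff.differentiable one_ne_zero

lemma continuousOn_flow (H : DecayingFlow G f T) (x : X) : ContinuousOn (f x) (Ici 0) :=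
  fun t ht => (H.flow x t ht).continuousWithinAt

lemma continuousOn_trans (H : DecayingFlow G f T) (x : X) : ContinuousOn (T x) (Ici 0) :=
  fun t ht => (H.trans x t ht).continuousWithinAt

lemma exists_bound (H : DecayingFlow G f T) (R : ℝ) : ∃ C : ℝ, 0 < C ∧
    ∀ x, ‖x‖ ≤ R → ∀ t, 0 ≤ t → ‖f x t‖ ≤ C ∧ ‖T x t‖ ≤ C := by
  obtain ⟨l, hl, h⟩ := H.decay
  obtain ⟨C, hC, h⟩ := h R
  refine ⟨C, hC, fun x hx t ht => ?_⟩
  have h1 : C * exp (-l * t) ≤ C := by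
    apply mul_le_of_le_one_right hC.le
    rw [exp_le_one_iff]; nlinarith
  exact ⟨(h x hx t ht).1.trans h1, (h x hx t ht).2.trans h1⟩

lemma exists_fderiv_bound [FiniteDimensional ℝ X] (H : DecayingFlow G f T) (C : ℝ) :
    ∃ L : ℝ, 0 < L ∧ ∀ y, ‖y‖ ≤ C → ‖fderiv ℝ G y‖ ≤ L := by
  have := FiniteDimensional.proper_real X
  obtain ⟨L, hL⟩ := (isCompact_closedBall (0 : X) C).exists_bound_of_continuousOn
    H.continuous_fderiv.continuousOn
  exact ⟨max L 1, by positivity, fun y hy => (hL y (by simpa using hy)).trans (le_max_left _ _)⟩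

lemma norm_sub_le [FiniteDimensional ℝ X] (H : DecayingFlow G f T) {C L : ℝ}
    (hL : ∀ y, ‖y‖ ≤ C → ‖fderiv ℝ G y‖ ≤ L) {a b : X} (ha : ‖a‖ ≤ C) (hb : ‖b‖ ≤ C) :
    ‖G b - G a‖ ≤ L * ‖b - a‖ :=
  (convex_closedBall (0 : X) C).norm_image_sub_le_of_norm_fderiv_le (𝕜 := ℝ)
    (fun y _ => H.differentiable y) (fun y hy => hL y (by simpa using hy))
    (by simpa using ha) (by simpa using hb)

/-- On bounded sets the flow is Lipschitz and the derivative of `G` is bounded along it. -/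
lemma exists_lipschitz [FiniteDimensional ℝ X] (H : DecayingFlow G f T) (R : ℝ) :
    ∃ C L : ℝ, 0 < C ∧ 0 < L ∧ ∀ x, ‖x‖ ≤ R → ∀ t, 0 ≤ t →
      ‖f x t‖ ≤ C ∧ ‖T x t‖ ≤ C ∧ ‖fderiv ℝ G (f x t)‖ ≤ L ∧
      ∀ y, ‖y‖ ≤ R → ‖G (f y t) - G (f x t)‖ ≤ L * ‖f y t - f x t‖ ∧
        ‖f y t - f x t‖ ≤ exp (L * t) * ‖y - x‖ := by
  obtain ⟨C, hC, h⟩ := H.exists_bound R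
  obtain ⟨L, hL, hD⟩ := H.exists_fderiv_bound C
  refine ⟨C, L, hC, hL, fun x hx t ht => ⟨(h x hx t ht).1, (h x hx t ht).2,
    hD _ (h x hx t ht).1, fun y hy =>
      ⟨H.norm_sub_le hD (h x hx t ht).1 (h y hy t ht).1, ?_⟩⟩⟩
  have := norm_le_of_norm_deriv_le (z := fun s => f y s - f x s) (δ := ‖y - x‖) hL le_rfl ht
    (fun s hs => (H.flow y s hs).sub (H.flow x s hs)) (by simp [H.init])
    (fun s hs => by
      simpa using H.norm_sub_le hD (h x hx s hs.1).1 (h y hy s hs.1).1)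
  simp only [zero_div, add_zero] at this
  linarith

lemma eventually_norm_fderiv_sub_le [FiniteDimensional ℝ X] (H : DecayingFlow G f T) (x : X)
    (t : ℝ) {ε : ℝ} (hε : 0 < ε) : ∀ᶠ y in 𝓝 x, ∀ s ∈ Icc 0 t,
      ∀ z ∈ Metric.closedBall (f x s) ‖f y s - f x s‖,
        ‖fderiv ℝ G z - fderiv ℝ G (f x s)‖ ≤ ε := by
  have := FiniteDimensional.proper_real X
  obtain ⟨C, L, hC, hL, h⟩ := H.exists_lipschitz (‖x‖ + 1)
  have hu := (isCompact_closedBall (0 : X) (C + 1)).uniformContinuousOn_of_continuous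
    H.continuous_fderiv.continuousOn
  obtain ⟨δ, hδ, hu⟩ := Metric.uniformContinuousOn_iff.1 hu ε hε
  have hm : 0 < min 1 (min 1 (δ / 2) * exp (-(L * t))) := by positivity
  filter_upwards [Metric.ball_mem_nhds x hm] with y hy s hs z hz
  rw [Metric.mem_ball, dist_eq_norm, lt_min_iff] at hy
  have hyR : ‖y‖ ≤ ‖x‖ + 1 := by
    have := norm_add_le x (y - x)
    rw [add_sub_cancel] at this
    linarith
  have hxs := h x (by linarith) s hs.1
  have h1 := (hxs.2.2.2 y hyR).2
  have h2 : ‖f y s - f x s‖ ≤ min 1 (δ / 2) := by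
    have h3 : exp (L * s) ≤ exp (L * t) := exp_le_exp.2 (by nlinarith [hs.2])
    calc _ ≤ exp (L * s) * ‖y - x‖ := h1
      _ ≤ exp (L * t) * (min 1 (δ / 2) * exp (-(L * t))) := by
        gcongr; exact hy.2.le
      _ = min 1 (δ / 2) := by
        rw [mul_comm, mul_assoc, ← exp_add]; simp
  rw [mem_closedBall_iff_norm] at hz
  have hz1 := (hz.trans h2).trans (min_le_left _ _)
  have hz2 := (hz.trans h2).trans (min_le_right _ _)
  have hzn : ‖z‖ ≤ C + 1 := by
    have := norm_add_le (f x s) (z - f x s)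
    rw [add_sub_cancel] at this
    linarith [hxs.1]
  have := hu z (by simpa using hzn) (f x s) (by simpa using hxs.1.trans (by linarith))
    (by rw [dist_eq_norm]; linarith)
  rw [dist_eq_norm] at this
  exact this.le

lemma continuous_trans [FiniteDimensional ℝ X] (H : DecayingFlow G f T) {t : ℝ} (ht : 0 ≤ t) :
    Continuous fun x => T x t := by
  rw [continuous_iff_continuousAt]
  intro x
  obtain ⟨C, L, hC, hL, h⟩ := H.exists_lipschitz (‖x‖ + 1)
  rw [Metric.continuousAt_iff']
  intro ε hε
  have hη : 0 < ε / 2 / (C / L * exp (L * t)) := by positivity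
  filter_upwards [H.eventually_norm_fderiv_sub_le x t hη, Metric.ball_mem_nhds x one_pos]
    with y hy hyb
  rw [Metric.mem_ball, dist_eq_norm] at hyb
  have hyR : ‖y‖ ≤ ‖x‖ + 1 := by
    have := norm_add_le x (y - x)
    rw [add_sub_cancel] at this
    linarith
  set η := ε / 2 / (C / L * exp (L * t)) with hηdef
  have key := norm_le_of_norm_deriv_le (z := fun s => T y s - T x s) (δ := 0) (ε := η * C) hL
    (by positivity) ht (fun s hs => (H.trans y s hs).sub (H.trans x s hs))
    (by simp [H.trans_init]) (fun s hs => by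
      have e : fderiv ℝ G (f y s) ∘L T y s - fderiv ℝ G (f x s) ∘L T x s =
          fderiv ℝ G (f y s) ∘L (T y s - T x s) +
            (fderiv ℝ G (f y s) - fderiv ℝ G (f x s)) ∘L T x s := by
        ext v; simp
      rw [e]
      have h1 := hy s hs (f y s) (by rw [mem_closedBall_iff_norm])
      have h2 := h x (by linarith) s hs.1
      have h3 := h y hyR s hs.1
      calc _ ≤ _ := norm_add_le _ _
        _ ≤ _ := add_le_add (ContinuousLinearMap.opNorm_comp_le _ _)
          (ContinuousLinearMap.opNorm_comp_le _ _)
        _ ≤ _ := by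
          gcongr
          · exact h3.2.2.1
          · exact h2.2.1)
  rw [dist_eq_norm]
  have e : (0 + η * C / L) * exp (L * t) = ε / 2 := by
    rw [hηdef]; field_simp; ring
  rw [e] at key
  exact key.trans_lt (by linarith)

lemma hasFDerivAt_flow [FiniteDimensional ℝ X] (H : DecayingFlow G f T) {t : ℝ} (ht : 0 ≤ t)
    (x : X) : HasFDerivAt (fun x => f x t) (T x t) x := by
  obtain ⟨C, L, hC, hL, h⟩ := H.exists_lipschitz (‖x‖ + 1)
  rw [hasFDerivAt_iff_isLittleO, Asymptotics.isLittleO_iff]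
  intro c hc
  have hη : 0 < c / (exp (L * t) / L * exp (L * t)) := by positivity
  filter_upwards [H.eventually_norm_fderiv_sub_le x t hη, Metric.ball_mem_nhds x one_pos]
    with y hy hyb
  rw [Metric.mem_ball, dist_eq_norm] at hyb
  have hyR : ‖y‖ ≤ ‖x‖ + 1 := by
    have := norm_add_le x (y - x)
    rw [add_sub_cancel] at this
    linarith
  set η := c / (exp (L * t) / L * exp (L * t)) with hηdef
  have key := norm_le_of_norm_deriv_le (z := fun s => f y s - f x s - T x s (y - x)) (δ := 0)
    (ε := η * (exp (L * t) * ‖y - x‖)) hL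
    (by positivity) ht (fun s hs => ((H.flow y s hs).sub (H.flow x s hs)).sub
      ((H.trans x s hs).clm_apply (hasDerivWithinAt_const s (Ici 0) (y - x))))
    (by simp [H.trans_init, H.init]) (fun s hs => by
      have h2 := h x (by linarith) s hs.1
      have h3 := (h2.2.2.2 y hyR).2
      have h4 := (convex_closedBall (f x s) ‖f y s - f x s‖).norm_image_sub_le_of_norm_fderiv_le'
        (𝕜 := ℝ) (x := f x s) (y := f y s)
        (fun y _ => H.differentiable y) (hy s hs) (by simp) (by simp [dist_eq_norm])
      have e : G (f y s) - G (f x s) - ((fderiv ℝ G (f x s) ∘L T x s) (y - x) + (T x s) 0) =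
          fderiv ℝ G (f x s) (f y s - f x s - T x s (y - x)) +
          (G (f y s) - G (f x s) - fderiv ℝ G (f x s) (f y s - f x s)) := by
        simp [map_sub]
      rw [e]
      have h5 : exp (L * s) ≤ exp (L * t) := exp_le_exp.2 (by nlinarith [hs.2])
      calc _ ≤ _ := norm_add_le _ _
        _ ≤ _ := add_le_add (ContinuousLinearMap.le_opNorm _ _) h4
        _ ≤ _ := by
          gcongr
          · exact h2.2.2.1
          · exact h3.trans (by gcongr))
  have e : (0 + η * (exp (L * t) * ‖y - x‖) / L) * exp (L * t) = c * ‖y - x‖ := by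
    rw [hηdef]; field_simp; ring
  rw [e] at key
  exact key

lemma flow_add [FiniteDimensional ℝ X] (H : DecayingFlow G f T) (x : X) {s t : ℝ} (hs : 0 ≤ s)
    (ht : 0 ≤ t) : f (f x s) t = f x (s + t) := by
  obtain ⟨C, hC, h⟩ := H.exists_bound ‖x‖
  obtain ⟨C', hC', h'⟩ := H.exists_bound ‖f x s‖
  obtain ⟨L, hL, hD⟩ := H.exists_fderiv_bound (max C C')
  refine eq_of_norm_deriv_sub_le (w := fun t => f x (s + t)) (w' := fun t => G (f x (s + t)))
    hL ht (H.flow (f x s)) (fun r hr => ?_)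
    (by simp [H.init]) fun r hr => ?_
  · exact hasDerivWithinAt_const_add hs (H.flow x (s + r) (by positivity))
  · exact H.norm_sub_le hD ((h x le_rfl _ (add_nonneg hs hr.1)).1.trans (le_max_left _ _))
      ((h' _ le_rfl _ hr.1).1.trans (le_max_right _ _))

lemma trans_add [FiniteDimensional ℝ X] (H : DecayingFlow G f T) (x : X) {s t : ℝ} (hs : 0 ≤ s)
    (ht : 0 ≤ t) : T (f x s) t ∘L T x s = T x (s + t) := by
  obtain ⟨C, L, hC, hL, h⟩ := H.exists_lipschitz ‖x‖
  refine eq_of_norm_deriv_sub_le (z := fun t => T (f x s) t ∘L T x s)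
    (w := fun t => T x (s + t))
    (w' := fun t => fderiv ℝ G (f x (s + t)) ∘L T x (s + t))
    hL ht (fun r hr => (H.trans (f x s) r hr).clm_comp (hasDerivWithinAt_const r (Ici 0) (T x s)))
    (fun r hr => ?_)
    (by simp [H.trans_init]) fun r hr => ?_
  · exact hasDerivWithinAt_const_add hs (H.trans x (s + r) (by positivity))
  · have e : (fderiv ℝ G (f (f x s) r) ∘L T (f x s) r) ∘L T x s + T (f x s) r ∘L 0 -
        fderiv ℝ G (f x (s + r)) ∘L T x (s + r) =
        fderiv ℝ G (f x (s + r)) ∘L (T (f x s) r ∘L T x s - T x (s + r)) := by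
      rw [H.flow_add x hs hr.1]; ext v; simp
    rw [e]
    refine (ContinuousLinearMap.opNorm_comp_le _ _).trans ?_
    gcongr
    exact (h x le_rfl _ (add_nonneg hs hr.1)).2.2.1

lemma trans_injective [FiniteDimensional ℝ X] (H : DecayingFlow G f T) (x : X) {t : ℝ}
    (ht : 0 ≤ t) : Function.Injective (T x t) := by
  rw [injective_iff_map_eq_zero]
  intro v hv
  obtain ⟨C, L, hC, hL, h⟩ := H.exists_lipschitz ‖x‖
  have hd : ∀ s, 0 ≤ s → HasDerivWithinAt (fun s => T x s v)
      (fderiv ℝ G (f x s) (T x s v)) (Ici 0) s := fun s hs => by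
    simpa using (H.trans x s hs).clm_apply (hasDerivWithinAt_const s (Ici 0) v)
  have := ODE_solution_unique_of_mem_Icc_left (a := 0) (b := t) (K := L.toNNReal)
    (v := fun s y => fderiv ℝ G (f x s) y) (s := fun _ => univ) (f := fun s => T x s v)
    (g := fun _ => 0)
    (fun s hs => by
      refine ((fderiv ℝ G (f x s)).lipschitz.weaken ?_).lipschitzOnWith
      rw [← NNReal.coe_le_coe, Real.coe_toNNReal _ hL.le]
      exact (h x le_rfl s hs.1.le).2.2.1)
    (fun s hs => ((hd s hs.1).continuousWithinAt).mono Icc_subset_Ici_self)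
    (fun s hs => ((hd s hs.1.le).hasDerivAt (Ici_mem_nhds hs.1)).hasDerivWithinAt)
    (fun _ _ => mem_univ _) continuousOn_const
    (fun s _ => by simpa using hasDerivWithinAt_const s (Iic s) (0 : X))
    (fun _ _ => mem_univ _) hv
  simpa [H.trans_init] using this ⟨le_rfl, ht⟩

lemma isUnit_trans [FiniteDimensional ℝ X] (H : DecayingFlow G f T) (x : X) {t : ℝ}
    (ht : 0 ≤ t) : IsUnit (T x t) := by
  have := FiniteDimensional.complete ℝ X
  rw [ContinuousLinearMap.isUnit_iff_bijective]
  exact ⟨H.trans_injective x ht, LinearMap.injective_iff_surjective.1 (H.trans_injective x ht)⟩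

end DecayingFlow

lemma hasDerivWithinAt_integral_of_continuousOn_Ici {E : Type*} [NormedAddCommGroup E]
    [NormedSpace ℝ E] [CompleteSpace E] {g : ℝ → E} (hg : ContinuousOn g (Ici 0)) {t : ℝ}
    (ht : 0 ≤ t) : HasDerivWithinAt (fun u => ∫ s in (0 : ℝ)..u, g s) (g t) (Ici 0) t := by
  have hc : Continuous fun s : ℝ => g (max s 0) :=
    hg.comp_continuous (by fun_prop) fun s => le_max_right s 0
  have hd := (hc.integral_hasStrictDerivAt 0 t).hasDerivAt.hasDerivWithinAt (s := Ici 0)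
  rw [max_eq_left ht] at hd
  have he : ∀ u : ℝ, 0 ≤ u → ∫ s in (0 : ℝ)..u, g s = ∫ s in (0 : ℝ)..u, g (max s 0) := by
    intro u hu
    refine intervalIntegral.integral_congr fun s hs => ?_
    rw [uIcc_of_le hu] at hs
    simp [max_eq_left hs.1]
  exact hd.congr (fun u hu => he u hu) (he t ht)

lemma integral_exp_neg_mul_le {l t : ℝ} (hl : 0 < l) :
    ∫ s in (0 : ℝ)..t, exp (-l * s) ≤ 1 / l := by
  have : ∫ s in (0 : ℝ)..t, exp (-l * s) = (1 - exp (-l * t)) / l := by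
    rw [intervalIntegral.integral_comp_mul_left _ (neg_ne_zero.2 hl.ne')]
    simp only [integral_exp, mul_zero, exp_zero, smul_eq_mul]
    field_simp
    ring
  rw [this]
  gcongr
  linarith [exp_pos (-l * t)]

section tangent

variable {X : Type*} [NormedAddCommGroup X] [NormedSpace ℝ X]

/-- The tangent lift of a vector field. -/
noncomputable def tangentField (G : X → X) (p : X × X) : X × X := (G p.1, fderiv ℝ G p.1 p.2)

/-- The tangent lift of a flow with transition matrix `T`. -/
noncomputable def tangentFlow (f : X → ℝ → X) (T : X → ℝ → X →L[ℝ] X) (p : X × X) (t : ℝ) : X × X :=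
  (f p.1 t, T p.1 t p.2)

/-- The inhomogeneity in the differential equation of the derivative of the transition matrix in
the direction `p.2`. -/
noncomputable def transForcing (G : X → X) (f : X → ℝ → X) (T : X → ℝ → X →L[ℝ] X)
    (p : X × X) (s : ℝ) : X →L[ℝ] X :=
  (fderiv ℝ (fderiv ℝ G) (f p.1 s)).flip (T p.1 s p.2) ∘L T p.1 s

/-- The derivative of the transition matrix in the direction `p.2`, by variation of constants. -/
noncomputable def transVariation (G : X → X) (f : X → ℝ → X) (T : X → ℝ → X →L[ℝ] X)
    (p : X × X) (t : ℝ) : X →L[ℝ] X :=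
  T p.1 t ∘L ∫ s in (0 : ℝ)..t, Ring.inverse (T p.1 s) ∘L transForcing G f T p s

/-- The transition matrix of the tangent lift. -/
noncomputable def tangentTrans (G : X → X) (f : X → ℝ → X) (T : X → ℝ → X →L[ℝ] X)
    (p : X × X) (t : ℝ) : X × X →L[ℝ] X × X :=
  ContinuousLinearMap.inl ℝ X X ∘L T p.1 t ∘L ContinuousLinearMap.fst ℝ X X +
    ContinuousLinearMap.inr ℝ X X ∘L (transVariation G f T p t ∘L ContinuousLinearMap.fst ℝ X X +
      T p.1 t ∘L ContinuousLinearMap.snd ℝ X X)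

lemma contDiff_tangentField {G : X → X} {m : ℕ} (hG : ContDiff ℝ (m + 1) G) :
    ContDiff ℝ m (tangentField G) :=
  ((hG.of_le le_self_add).comp contDiff_fst).prodMk
    (((hG.fderiv_right le_rfl).comp contDiff_fst).clm_apply contDiff_snd)

lemma fderiv_tangentField_apply {G : X → X} (hG : ContDiff ℝ 2 G) (p q : X × X) :
    fderiv ℝ (tangentField G) p q = (fderiv ℝ G p.1 q.1,
      fderiv ℝ (fderiv ℝ G) p.1 q.1 p.2 + fderiv ℝ G p.1 q.2) := by
  have h1 : HasFDerivAt (fun p : X × X => G p.1) _ p :=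
    ((hG.differentiable two_ne_zero) p.1).hasFDerivAt.comp p hasFDerivAt_fst
  have hG' : Differentiable ℝ (fderiv ℝ G) :=
    (hG.fderiv_right (m := 1) (by norm_num)).differentiable one_ne_zero
  have h2 : HasFDerivAt (fun p : X × X => fderiv ℝ G p.1) _ p :=
    (hG' p.1).hasFDerivAt.comp p hasFDerivAt_fst
  have h3 := h1.prodMk (h2.clm_apply hasFDerivAt_snd)
  have : fderiv ℝ (tangentField G) p = _ := h3.fderiv
  rw [this]
  simp [add_comm]

namespace DecayingFlow

variable {G : X → X} {f : X → ℝ → X} {T : X → ℝ → X →L[ℝ] X}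

lemma continuousOn_transForcing (H : DecayingFlow G f T) (hG : ContDiff ℝ 2 G) (p : X × X) :
    ContinuousOn (transForcing G f T p) (Ici 0) := by
  have hG' : Continuous (fderiv ℝ (fderiv ℝ G)) :=
    (hG.fderiv_right (m := 1) (by norm_num)).continuous_fderiv one_ne_zero
  have h1 := hG'.comp_continuousOn (H.continuousOn_flow p.1)
  have h2 := (H.continuousOn_trans p.1)
  have h4 : ContinuousOn (fun s => (fderiv ℝ (fderiv ℝ G) (f p.1 s)).flip) (Ici 0) :=
    (ContinuousLinearMap.flipₗᵢ ℝ X X X).continuous.comp_continuousOn h1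
  exact (h4.clm_apply (h2.clm_apply continuousOn_const)).clm_comp h2

variable [FiniteDimensional ℝ X]

lemma continuousOn_inverse_trans (H : DecayingFlow G f T) (x : X) :
    ContinuousOn (fun s => Ring.inverse (T x s)) (Ici 0) := by
  have := FiniteDimensional.complete ℝ X
  intro s hs
  obtain ⟨u, hu⟩ := H.isUnit_trans x hs
  have := NormedRing.inverse_continuousAt u
  rw [hu] at this
  exact this.comp_continuousWithinAt (H.continuousOn_trans x s hs)

lemma hasDerivWithinAt_transVariation (H : DecayingFlow G f T) (hG : ContDiff ℝ 2 G) (p : X × X)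
    {t : ℝ} (ht : 0 ≤ t) : HasDerivWithinAt (transVariation G f T p)
      (fderiv ℝ G (f p.1 t) ∘L transVariation G f T p t + transForcing G f T p t) (Ici 0) t := by
  have := FiniteDimensional.complete ℝ X
  have h := (H.trans p.1 t ht).clm_comp (hasDerivWithinAt_integral_of_continuousOn_Ici
    ((H.continuousOn_inverse_trans p.1).clm_comp (H.continuousOn_transForcing hG p)) ht)
  refine h.congr_deriv ?_
  have hi : T p.1 t * Ring.inverse (T p.1 t) = 1 :=
    Ring.mul_inverse_cancel _ (H.isUnit_trans p.1 ht)
  have : T p.1 t ∘L Ring.inverse (T p.1 t) ∘L transForcing G f T p t = transForcing G f T p t := by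
    rw [← ContinuousLinearMap.comp_assoc]
    change (T p.1 t * Ring.inverse (T p.1 t)) * _ = _
    rw [hi, one_mul]
  rw [this]
  rfl

lemma transVariation_eq (H : DecayingFlow G f T) (hG : ContDiff ℝ 2 G) (p : X × X)
    {t : ℝ} (ht : 0 ≤ t) : transVariation G f T p t =
      ∫ s in (0 : ℝ)..t, T (f p.1 s) (t - s) ∘L transForcing G f T p s := by
  have := FiniteDimensional.complete ℝ X
  have hc := (H.continuousOn_inverse_trans p.1).clm_comp (H.continuousOn_transForcing hG p)
  have hi : IntervalIntegrable (fun s => Ring.inverse (T p.1 s) ∘L transForcing G f T p s)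
      MeasureTheory.volume 0 t :=
    (hc.mono (by rw [uIcc_of_le ht]; exact Icc_subset_Ici_self)).intervalIntegrable
  have h := (ContinuousLinearMap.compL ℝ X X X (T p.1 t)).intervalIntegral_comp_comm hi
  simp only [ContinuousLinearMap.compL_apply] at h
  rw [transVariation, ← h]
  refine intervalIntegral.integral_congr fun s hs => ?_
  rw [uIcc_of_le ht] at hs
  have hu : T p.1 s * Ring.inverse (T p.1 s) = 1 :=
    Ring.mul_inverse_cancel _ (H.isUnit_trans p.1 hs.1)
  have ha := H.trans_add p.1 hs.1 (sub_nonneg.2 hs.2)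
  rw [add_sub_cancel] at ha
  change T p.1 t * (Ring.inverse (T p.1 s) * transForcing G f T p s) = T (f p.1 s) (t - s) * _
  change T (f p.1 s) (t - s) * T p.1 s = T p.1 t at ha
  rw [← ha, mul_assoc, ← mul_assoc (T p.1 s), hu, one_mul]

lemma exists_tangent_decay (H : DecayingFlow G f T) (hG : ContDiff ℝ 2 G) :
    ∃ l : ℝ, 0 < l ∧ ∀ R : ℝ, ∃ C : ℝ, 0 < C ∧ ∀ p, ‖p‖ ≤ R → ∀ t, 0 ≤ t →
      ‖tangentFlow f T p t‖ ≤ C * exp (-l * t) ∧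
      ‖tangentTrans G f T p t‖ ≤ C * exp (-l * t) := by
  have := FiniteDimensional.proper_real X
  obtain ⟨l, hl, hdec⟩ := H.decay
  refine ⟨l, hl, fun R => ?_⟩
  obtain ⟨C, hC, h⟩ := hdec R
  obtain ⟨C₁, hC₁, h₁⟩ := hdec C
  have hG' : Continuous (fderiv ℝ (fderiv ℝ G)) :=
    (hG.fderiv_right (m := 1) (by norm_num)).continuous_fderiv one_ne_zero
  obtain ⟨M, hM⟩ := (isCompact_closedBall (0 : X) C).exists_bound_of_continuousOn
    hG'.continuousOn
  set K := C₁ * (|M| * (C * |R|) * C) with hK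
  have hK0 : 0 ≤ K := by positivity
  refine ⟨C * (1 + |R|) + (K / l + C), by positivity, fun p hp t ht => ?_⟩
  have hp1 : ‖p.1‖ ≤ R := (norm_fst_le p).trans hp
  have hp2 : ‖p.2‖ ≤ |R| := ((norm_snd_le p).trans hp).trans (le_abs_self R)
  have hR : 0 ≤ |R| := abs_nonneg R
  have he := exp_pos (-l * t)
  have hf := (h p.1 hp1 t ht).1
  have hT := (h p.1 hp1 t ht).2
  have hKl : 0 ≤ K / l := by positivity
  have hCe : 0 ≤ C * exp (-l * t) := by positivity
  have hV : ‖transVariation G f T p t‖ ≤ K / l * exp (-l * t) := by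
    rw [H.transVariation_eq hG p ht]
    have hb : ‖∫ s in (0 : ℝ)..t, T (f p.1 s) (t - s) ∘L transForcing G f T p s‖ ≤
        ∫ s in (0 : ℝ)..t, K * exp (-l * t) * exp (-l * s) := by
      refine intervalIntegral.norm_integral_le_of_norm_le ht (Eventually.of_forall fun s hs => ?_)
        (Continuous.intervalIntegrable (by fun_prop) _ _)
      have hs0 := hs.1.le
      have a1 := h p.1 hp1 s hs0
      have a2 : ‖f p.1 s‖ ≤ C := a1.1.trans (mul_le_of_le_one_right hC.le (by
        rw [exp_le_one_iff]; nlinarith))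
      have a3 := (h₁ _ a2 (t - s) (sub_nonneg.2 hs.2)).2
      have a4 : ‖fderiv ℝ (fderiv ℝ G) (f p.1 s)‖ ≤ |M| :=
        (hM _ (by simpa using a2)).trans (le_abs_self M)
      have a5 : ‖T p.1 s p.2‖ ≤ C * exp (-l * s) * |R| :=
        (ContinuousLinearMap.le_opNorm _ _).trans (by gcongr; exact a1.2)
      have a6 : ‖transForcing G f T p s‖ ≤
          |M| * (C * exp (-l * s) * |R|) * (C * exp (-l * s)) := by
        refine (ContinuousLinearMap.opNorm_comp_le _ _).trans ?_
        gcongr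
        · refine (ContinuousLinearMap.le_opNorm _ _).trans ?_
          rw [ContinuousLinearMap.opNorm_flip]
          gcongr
        · exact a1.2
      calc _ ≤ _ := ContinuousLinearMap.opNorm_comp_le _ _
        _ ≤ C₁ * exp (-l * (t - s)) * (|M| * (C * exp (-l * s) * |R|) * (C * exp (-l * s))) := by
          gcongr
        _ = K * (exp (-l * (t - s)) * exp (-l * s)) * exp (-l * s) := by rw [hK]; ring
        _ = _ := by rw [← exp_add]; congr 3; ring_nf
    rw [intervalIntegral.integral_const_mul] at hb
    calc _ ≤ _ := hb
      _ ≤ K * exp (-l * t) * (1 / l) := by gcongr; exact integral_exp_neg_mul_le hl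
      _ = _ := by ring
  constructor
  · have h2 : ‖T p.1 t p.2‖ ≤ C * exp (-l * t) * |R| :=
      (ContinuousLinearMap.le_opNorm _ _).trans (by gcongr)
    refine (norm_prod_le_iff).2 ⟨hf.trans ?_, h2.trans ?_⟩
    · nlinarith [mul_nonneg hCe hR, mul_nonneg hKl he.le]
    · nlinarith [mul_nonneg hCe hR, mul_nonneg hKl he.le]
  · refine ContinuousLinearMap.opNorm_le_bound _ (by positivity) fun q => ?_
    have hq : tangentTrans G f T p t q =
        (T p.1 t q.1, transVariation G f T p t q.1 + T p.1 t q.2) := by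
      simp [tangentTrans]
    rw [hq]
    have b1 : ‖T p.1 t q.1‖ ≤ C * exp (-l * t) * ‖q‖ :=
      (ContinuousLinearMap.le_opNorm _ _).trans (by gcongr; exact norm_fst_le q)
    have b2 : ‖T p.1 t q.2‖ ≤ C * exp (-l * t) * ‖q‖ :=
      (ContinuousLinearMap.le_opNorm _ _).trans (by gcongr; exact norm_snd_le q)
    have b3 : ‖transVariation G f T p t q.1‖ ≤ K / l * exp (-l * t) * ‖q‖ :=
      (ContinuousLinearMap.le_opNorm _ _).trans (by gcongr; exact norm_fst_le q)
    have hq0 := norm_nonneg q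
    refine (norm_prod_le_iff).2 ⟨b1.trans ?_, (norm_add_le _ _).trans ?_⟩
    · exact mul_le_mul_of_nonneg_right (mul_le_mul_of_nonneg_right
        (by nlinarith [mul_nonneg hC.le hR]) he.le) hq0
    · refine (add_le_add b3 b2).trans ?_
      rw [← add_mul, ← add_mul]
      exact mul_le_mul_of_nonneg_right (mul_le_mul_of_nonneg_right
        (by nlinarith [mul_nonneg hC.le hR]) he.le) hq0

/-- The tangent lift of a decaying flow is a decaying flow. -/
theorem tangent (H : DecayingFlow G f T) (hG : ContDiff ℝ 2 G) :
    DecayingFlow (tangentField G) (tangentFlow f T) (tangentTrans G f T) where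
  contDiff := by exact_mod_cast contDiff_tangentField (m := 1) (by norm_num; exact hG)
  init p := by simp [tangentFlow, H.init, H.trans_init]
  flow p t ht := by
    have h := (H.trans p.1 t ht).clm_apply (hasDerivWithinAt_const t (Ici 0) p.2)
    exact ((H.flow p.1 t ht).prodMk h).congr_deriv (by simp [tangentField, tangentFlow])
  trans_init p := by
    ext q <;> simp [tangentTrans, transVariation, H.trans_init]
  trans p t ht := by
    have hT := (H.trans p.1 t ht)
    have hV := H.hasDerivWithinAt_transVariation hG p ht
    have hfst := hasDerivWithinAt_const t (Ici 0) (ContinuousLinearMap.fst ℝ X X)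
    have hsnd := hasDerivWithinAt_const t (Ici 0) (ContinuousLinearMap.snd ℝ X X)
    have hinl := hasDerivWithinAt_const t (Ici 0) (ContinuousLinearMap.inl ℝ X X)
    have hinr := hasDerivWithinAt_const t (Ici 0) (ContinuousLinearMap.inr ℝ X X)
    have h := (hinl.clm_comp (hT.clm_comp hfst)).add
      (hinr.clm_comp ((hV.clm_comp hfst).add (hT.clm_comp hsnd)))
    refine h.congr_deriv (ContinuousLinearMap.ext fun q => ?_)
    rw [ContinuousLinearMap.comp_apply, fderiv_tangentField_apply hG]
    simp [tangentTrans, tangentFlow, transForcing]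
    abel
  decay := H.exists_tangent_decay hG

end DecayingFlow

end tangent

open MeasureTheory in
lemma integrableOn_and_continuous_integral_of_exp_decay {X E : Type*} [NormedAddCommGroup X]
    [NormedAddCommGroup E] [NormedSpace ℝ E] {g : X → ℝ → E}
    (hx : ∀ s, 0 ≤ s → Continuous fun x => g x s) (hs : ∀ x, ContinuousOn (g x) (Ici 0))
    (hb : ∃ l : ℝ, 0 < l ∧ ∀ R : ℝ, ∃ C : ℝ, ∀ x, ‖x‖ ≤ R → ∀ s, 0 ≤ s →
      ‖g x s‖ ≤ C * exp (-l * s)) :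
    (∀ x, IntegrableOn (g x) (Ioi 0)) ∧ Continuous fun x => ∫ s in Ioi (0 : ℝ), g x s := by
  obtain ⟨l, hl, hb⟩ := hb
  have hm : ∀ x, AEStronglyMeasurable (g x) (volume.restrict (Ioi 0)) := fun x =>
    ((hs x).mono Ioi_subset_Ici_self).aestronglyMeasurable measurableSet_Ioi
  have hi : ∀ C : ℝ, IntegrableOn (fun s => C * exp (-l * s)) (Ioi 0) := fun C =>
    (exp_neg_integrableOn_Ioi 0 hl).const_mul C
  have hae : ∀ {x : X} {C : ℝ}, (∀ s, 0 ≤ s → ‖g x s‖ ≤ C * exp (-l * s)) →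
      ∀ᵐ s ∂volume.restrict (Ioi 0), ‖g x s‖ ≤ C * exp (-l * s) := fun h =>
    (ae_restrict_iff' measurableSet_Ioi).2 (Eventually.of_forall fun s hs => h s (le_of_lt hs))
  refine ⟨fun x => ?_, continuous_iff_continuousAt.2 fun x => ?_⟩
  · obtain ⟨C, hC⟩ := hb ‖x‖
    exact Integrable.mono' (hi C) (hm x) (hae (hC x le_rfl))
  · obtain ⟨C, hC⟩ := hb (‖x‖ + 1)
    refine continuousAt_of_dominated (Eventually.of_forall hm) ?_ (hi C)
      ((ae_restrict_iff' measurableSet_Ioi).2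
        (Eventually.of_forall fun s hs => (hx s (le_of_lt hs)).continuousAt))
    filter_upwards [continuous_norm.continuousAt.eventually_le_const
      (show ‖x‖ < ‖x‖ + 1 by linarith)] with y hy
    exact hae (hC y hy)

section quadIntegral

variable {X : Type*} [NormedAddCommGroup X] [NormedSpace ℝ X]

/-- The integral of the quadratic form of `B` along the trajectory starting from `x`. -/
noncomputable def quadIntegral (B : X →L[ℝ] X →L[ℝ] ℝ) (f : X → ℝ → X) (x : X) : ℝ :=
  ∫ s in Ioi (0 : ℝ), B (f x s) (f x s)

/-- The derivative of `y ↦ B y y` along the flow `f` with transition matrix `T`. -/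
noncomputable def quadDeriv (B : X →L[ℝ] X →L[ℝ] ℝ) (f : X → ℝ → X) (T : X → ℝ → X →L[ℝ] X)
    (x : X) (s : ℝ) : X →L[ℝ] ℝ :=
  B (f x s) ∘L T x s + B.flip (f x s) ∘L T x s

/-- The bilinear form on the tangent space whose quadratic form is the derivative of that
of `B`. -/
noncomputable def tangentForm (B : X →L[ℝ] X →L[ℝ] ℝ) : X × X →L[ℝ] X × X →L[ℝ] ℝ :=
  (B + B.flip).bilinearComp (ContinuousLinearMap.fst ℝ X X) (ContinuousLinearMap.snd ℝ X X)

namespace DecayingFlow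

variable {G : X → X} {f : X → ℝ → X} {T : X → ℝ → X →L[ℝ] X}

lemma exists_quadDeriv_bound (H : DecayingFlow G f T) (B : X →L[ℝ] X →L[ℝ] ℝ) :
    ∃ l : ℝ, 0 < l ∧ ∀ R : ℝ, ∃ C : ℝ, ∀ x, ‖x‖ ≤ R → ∀ s, 0 ≤ s →
      ‖B (f x s) (f x s)‖ ≤ C * exp (-l * s) ∧ ‖quadDeriv B f T x s‖ ≤ C * exp (-l * s) := by
  obtain ⟨l, hl, h⟩ := H.decay
  refine ⟨l, hl, fun R => ?_⟩
  obtain ⟨C, hC, h⟩ := h R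
  refine ⟨2 * ‖B‖ * C * C, fun x hx s hs => ?_⟩
  obtain ⟨h1, h2⟩ := h x hx s hs
  have he : exp (-l * s) ≤ 1 := by
    rw [exp_le_one_iff]; nlinarith
  have h3 : ‖f x s‖ ≤ C := h1.trans (mul_le_of_le_one_right hC.le he)
  have h4 : ‖B (f x s)‖ ≤ ‖B‖ * C := (B.le_opNorm _).trans (by gcongr)
  have h5 : ‖B.flip (f x s)‖ ≤ ‖B‖ * C :=
    (B.flip.le_opNorm _).trans (by rw [B.opNorm_flip]; gcongr)
  have hp : 0 ≤ ‖B‖ * C * (C * exp (-l * s)) := by positivity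
  constructor
  · have : ‖B (f x s) (f x s)‖ ≤ ‖B‖ * C * (C * exp (-l * s)) :=
      ((B (f x s)).le_opNorm _).trans (by gcongr)
    linarith
  · have a : ‖B (f x s) ∘L T x s‖ ≤ ‖B‖ * C * (C * exp (-l * s)) :=
      (ContinuousLinearMap.opNorm_comp_le _ _).trans (by gcongr)
    have b : ‖B.flip (f x s) ∘L T x s‖ ≤ ‖B‖ * C * (C * exp (-l * s)) :=
      (ContinuousLinearMap.opNorm_comp_le _ _).trans (by gcongr)
    have := norm_add_le (B (f x s) ∘L T x s) (B.flip (f x s) ∘L T x s)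
    rw [quadDeriv]
    linarith

lemma continuousOn_quadDeriv (H : DecayingFlow G f T) (B : X →L[ℝ] X →L[ℝ] ℝ) (x : X) :
    ContinuousOn (quadDeriv B f T x) (Ici 0) := by
  have h1 := H.continuousOn_flow x
  have h2 := H.continuousOn_trans x
  exact ((B.continuous.comp_continuousOn h1).clm_comp h2).add
    ((B.flip.continuous.comp_continuousOn h1).clm_comp h2)

lemma continuousOn_quad (H : DecayingFlow G f T) (B : X →L[ℝ] X →L[ℝ] ℝ) (x : X) :
    ContinuousOn (fun s => B (f x s) (f x s)) (Ici 0) :=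
  (B.continuous.comp_continuousOn (H.continuousOn_flow x)).clm_apply (H.continuousOn_flow x)

variable [FiniteDimensional ℝ X]

lemma continuous_flow (H : DecayingFlow G f T) {t : ℝ} (ht : 0 ≤ t) :
    Continuous fun x => f x t :=
  continuous_iff_continuousAt.2 fun x => (H.hasFDerivAt_flow ht x).continuousAt

lemma quadDeriv_integrable_and_continuous (H : DecayingFlow G f T) (B : X →L[ℝ] X →L[ℝ] ℝ) :
    (∀ x, MeasureTheory.IntegrableOn (quadDeriv B f T x) (Ioi 0)) ∧
      Continuous fun x => ∫ s in Ioi (0 : ℝ), quadDeriv B f T x s := by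
  obtain ⟨l, hl, h⟩ := H.exists_quadDeriv_bound B
  refine integrableOn_and_continuous_integral_of_exp_decay (fun s hs => ?_)
    (H.continuousOn_quadDeriv B) ⟨l, hl, fun R => ?_⟩
  · have h1 := H.continuous_flow hs
    have h2 := H.continuous_trans hs
    exact ((B.continuous.comp h1).clm_comp h2).add ((B.flip.continuous.comp h1).clm_comp h2)
  · obtain ⟨C, hC⟩ := h R
    exact ⟨C, fun x hx s hs => (hC x hx s hs).2⟩

open MeasureTheory in
lemma hasFDerivAt_quadIntegral (H : DecayingFlow G f T) (B : X →L[ℝ] X →L[ℝ] ℝ) (x : X) :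
    HasFDerivAt (quadIntegral B f) (∫ s in Ioi (0 : ℝ), quadDeriv B f T x s) x := by
  obtain ⟨l, hl, h⟩ := H.exists_quadDeriv_bound B
  obtain ⟨C, hC⟩ := h (‖x‖ + 1)
  have hm : ∀ x, AEStronglyMeasurable (fun s => B (f x s) (f x s))
      (volume.restrict (Ioi 0)) := fun x =>
    ((H.continuousOn_quad B x).mono Ioi_subset_Ici_self).aestronglyMeasurable measurableSet_Ioi
  have hi : IntegrableOn (fun s => C * exp (-l * s)) (Ioi 0) :=
    (exp_neg_integrableOn_Ioi 0 hl).const_mul C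
  have hball : ∀ y ∈ Metric.ball x 1, ‖y‖ ≤ ‖x‖ + 1 := fun y hy => by
    have := norm_add_le x (y - x)
    rw [add_sub_cancel] at this
    rw [Metric.mem_ball, dist_eq_norm] at hy
    linarith
  refine hasFDerivAt_integral_of_dominated_of_fderiv_le (Metric.ball_mem_nhds x one_pos)
    (Eventually.of_forall hm) (Integrable.mono' hi (hm x) ?_)
    ((H.quadDeriv_integrable_and_continuous B).1 x).aestronglyMeasurable ?_ hi ?_
  · exact (ae_restrict_iff' measurableSet_Ioi).2 (Eventually.of_forall fun s hs =>
      (hC x (by linarith) s (le_of_lt hs)).1)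
  · exact (ae_restrict_iff' measurableSet_Ioi).2 (Eventually.of_forall fun s hs y hy =>
      (hC y (hball y hy) s (le_of_lt hs)).2)
  · refine (ae_restrict_iff' measurableSet_Ioi).2 (Eventually.of_forall fun s hs y _ => ?_)
    have hf := H.hasFDerivAt_flow (le_of_lt hs) y
    refine ((B.hasFDerivAt.comp y hf).clm_apply hf).congr_fderiv ?_
    ext v
    simp [quadDeriv]

lemma integral_quadDeriv_apply (H : DecayingFlow G f T) (B : X →L[ℝ] X →L[ℝ] ℝ) (x v : X) :
    (∫ s in Ioi (0 : ℝ), quadDeriv B f T x s) v =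
      quadIntegral (tangentForm B) (tangentFlow f T) (x, v) := by
  rw [ContinuousLinearMap.integral_apply ((H.quadDeriv_integrable_and_continuous B).1 x)]
  simp [quadIntegral, quadDeriv, tangentForm, tangentFlow]

end DecayingFlow

/-- The integral of a quadratic form along a decaying flow is as smooth as the vector field. -/
theorem DecayingFlow.contDiff_quadIntegral (m : ℕ) :
    ∀ {X : Type*} [NormedAddCommGroup X] [NormedSpace ℝ X] [FiniteDimensional ℝ X]
      {G : X → X} {f : X → ℝ → X} {T : X → ℝ → X →L[ℝ] X}, DecayingFlow G f T →
      ContDiff ℝ (m + 1) G → ∀ B : X →L[ℝ] X →L[ℝ] ℝ, ContDiff ℝ (m + 1) (quadIntegral B f) := by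
  induction m with
  | zero =>
    intro X _ _ _ G f T H _ B
    simp only [Nat.cast_zero, zero_add]
    exact contDiff_one_iff_hasFDerivAt.2
      ⟨_, (H.quadDeriv_integrable_and_continuous B).2, H.hasFDerivAt_quadIntegral B⟩
  | succ m ih =>
    intro X _ _ _ G f T H hG B
    have hG2 : ContDiff ℝ 2 G := hG.of_le (by
      have : ((2 : ℕ) : WithTop ℕ∞) ≤ ((m + 1 + 1 : ℕ) : WithTop ℕ∞) := by
        exact_mod_cast (by omega : 2 ≤ m + 1 + 1)
      exact_mod_cast this)
    have hT := ih (H.tangent hG2) (by exact_mod_cast contDiff_tangentField hG) (tangentForm B)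
    refine contDiff_succ_iff_fderiv_apply.2 ⟨fun x => (H.hasFDerivAt_quadIntegral B
      x).differentiableAt, fun h => absurd h (by simp), fun v => ?_⟩
    simp only [(H.hasFDerivAt_quadIntegral B _).fderiv, H.integral_quadDeriv_apply]
    exact_mod_cast hT.comp (contDiff_id.prodMk contDiff_const)

end quadIntegral

section gramian

open ContinuousLinearMap (adjoint)

variable {E : Type*} [NormedAddCommGroup E] [InnerProductSpace ℝ E] [CompleteSpace E]

/-- The observability Gramian `∫₀^∞ Φᵀ Q Φ`. -/
noncomputable def gramian (Q : E →L[ℝ] E) (Φ : E → ℝ → E →L[ℝ] E) (e : E) : E →L[ℝ] E :=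
  ∫ s in Ioi (0 : ℝ), adjoint (Φ e s) ∘L Q ∘L Φ e s

namespace DecayingFlow

variable {F : E → E} {f : E → ℝ → E} {Φ : E → ℝ → E →L[ℝ] E}

lemma continuousOn_gramian_integrand (H : DecayingFlow F f Φ) (Q : E →L[ℝ] E) (e : E) :
    ContinuousOn (fun s => adjoint (Φ e s) ∘L Q ∘L Φ e s) (Ici 0) := by
  have h2 := H.continuousOn_trans e
  exact (adjoint.continuous.comp_continuousOn h2).clm_comp (continuousOn_const.clm_comp h2)

variable [FiniteDimensional ℝ E]

lemma gramian_integrable_and_continuous (H : DecayingFlow F f Φ) (Q : E →L[ℝ] E) :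
    (∀ e, MeasureTheory.IntegrableOn (fun s => adjoint (Φ e s) ∘L Q ∘L Φ e s) (Ioi 0)) ∧
      Continuous (gramian Q Φ) := by
  obtain ⟨l, hl, h⟩ := H.decay
  refine integrableOn_and_continuous_integral_of_exp_decay (fun s hs => ?_)
    (H.continuousOn_gramian_integrand Q) ⟨l, hl, fun R => ?_⟩
  · have h2 := H.continuous_trans hs
    exact (adjoint.continuous.comp h2).clm_comp (continuous_const.clm_comp h2)
  · obtain ⟨C, hC, h⟩ := h R
    refine ⟨C * (‖Q‖ * C), fun x hx s hs => ?_⟩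
    have h2 := (h x hx s hs).2
    have he : exp (-l * s) ≤ 1 := by
      rw [exp_le_one_iff]; nlinarith
    have h3 : ‖Φ x s‖ ≤ C := h2.trans (mul_le_of_le_one_right hC.le he)
    calc _ ≤ ‖adjoint (Φ x s)‖ * (‖Q‖ * ‖Φ x s‖) :=
          (ContinuousLinearMap.opNorm_comp_le _ _).trans (by
            gcongr; exact ContinuousLinearMap.opNorm_comp_le _ _)
      _ ≤ C * (‖Q‖ * (C * exp (-l * s))) := by
          rw [LinearIsometryEquiv.norm_map]; gcongr
      _ = _ := by ring

lemma inner_gramian (H : DecayingFlow F f Φ) (Q : E →L[ℝ] E) (e v w : E) :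
    ⟪gramian Q Φ e v, w⟫ = ∫ s in Ioi (0 : ℝ), ⟪Q (Φ e s v), Φ e s w⟫ := by
  have hi := (H.gramian_integrable_and_continuous Q).1 e
  rw [gramian, ContinuousLinearMap.integral_apply hi, real_inner_comm,
    ← integral_inner (hi.apply_continuousLinearMap v)]
  refine MeasureTheory.integral_congr_ae (Eventually.of_forall fun s => ?_)
  simp [real_inner_comm, ContinuousLinearMap.adjoint_inner_right]

lemma inner_gramian_symm (H : DecayingFlow F f Φ) {Q : E →L[ℝ] E} (hQ : IsSelfAdjoint Q)
    (e v w : E) : ⟪gramian Q Φ e v, w⟫ = ⟪gramian Q Φ e w, v⟫ := by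
  rw [H.inner_gramian, H.inner_gramian]
  refine MeasureTheory.integral_congr_ae (Eventually.of_forall fun s => ?_)
  have := hQ.isSymmetric (Φ e s v) (Φ e s w)
  simp only [ContinuousLinearMap.coe_coe] at this
  simp only [this, real_inner_comm]

lemma inner_gramian_pos (H : DecayingFlow F f Φ) {Q : E →L[ℝ] E}
    (hQ : ∀ v, v ≠ 0 → 0 < ⟪Q v, v⟫) (e : E) {v : E} (hv : v ≠ 0) :
    0 < ⟪gramian Q Φ e v, v⟫ := by
  have hi := (H.gramian_integrable_and_continuous Q).1 e
  have hpos : ∀ s ∈ Ioi (0 : ℝ), 0 < ⟪Q (Φ e s v), Φ e s v⟫ := fun s hs =>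
    hQ _ fun h => hv ((injective_iff_map_eq_zero _).1 (H.trans_injective e (le_of_lt hs)) v h)
  have hint : MeasureTheory.IntegrableOn (fun s => ⟪Q (Φ e s v), Φ e s v⟫) (Ioi 0) := by
    have := (hi.apply_continuousLinearMap v).inner_const (𝕜 := ℝ) v
    simp only [ContinuousLinearMap.comp_apply, ContinuousLinearMap.adjoint_inner_left] at this
    exact this
  have hsupp : Function.support (fun s => ⟪Q (Φ e s v), Φ e s v⟫) ∩ Ioi 0 = Ioi 0 :=
    inter_eq_right.2 fun s hs => (hpos s hs).ne'
  rw [H.inner_gramian, MeasureTheory.setIntegral_pos_iff_support_of_nonneg_ae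
    ((MeasureTheory.ae_restrict_iff' measurableSet_Ioi).2
      (Eventually.of_forall fun s hs => (hpos s hs).le)) hint, hsupp]
  simp

lemma exists_antitone_lower_bound (H : DecayingFlow F f Φ) {Q : E →L[ℝ] E}
    (hQ : ∀ v, v ≠ 0 → 0 < ⟪Q v, v⟫) :
    ∃ pl : ℝ → ℝ, AntitoneOn pl (Ici 0) ∧ (∀ s, 0 ≤ s → 0 < pl s) ∧
      ∀ e v, pl ‖e‖ * ‖v‖ ^ 2 ≤ ⟪gramian Q Φ e v, v⟫ := by
  have := FiniteDimensional.proper_real E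
  have hc := (H.gramian_integrable_and_continuous Q).2
  set S : ℝ → Set ℝ := fun r => {c | c ≤ 1 ∧ ∀ e : E, ‖e‖ ≤ r → ∀ v,
    c * ‖v‖ ^ 2 ≤ ⟪gramian Q Φ e v, v⟫} with hS
  have hbdd : ∀ r, BddAbove (S r) := fun r => ⟨1, fun c hc => hc.1⟩
  have hex : ∀ r, ∃ c ∈ S r, 0 < c := by
    intro r
    have hcont : Continuous fun p : E × E => ⟪gramian Q Φ p.1 p.2, p.2⟫ :=
      ((hc.comp continuous_fst).clm_apply continuous_snd).inner continuous_snd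
    obtain ⟨c, hc0, hc⟩ := ((isCompact_closedBall (0 : E) r).prod
      (isCompact_sphere (0 : E) 1)).exists_forall_le' (a := 0) hcont.continuousOn (by
        rintro ⟨e, v⟩ ⟨-, hv⟩
        exact H.inner_gramian_pos hQ e (ne_zero_of_mem_unit_sphere ⟨v, hv⟩))
    refine ⟨min c 1, ⟨min_le_right _ _, fun e he v => ?_⟩, lt_min hc0 one_pos⟩
    rcases eq_or_ne v 0 with rfl | hv
    · simp
    · have hn : 0 < ‖v‖ := norm_pos_iff.2 hv
      have h := hc (e, ‖v‖⁻¹ • v) ⟨by simpa using he, by simp [norm_smul, hn.ne']⟩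
      simp only [map_smul, real_inner_smul_left, real_inner_smul_right] at h
      calc _ ≤ (‖v‖⁻¹ * (‖v‖⁻¹ * ⟪gramian Q Φ e v, v⟫)) * ‖v‖ ^ 2 := by
            gcongr; exact (min_le_left _ _).trans h
        _ = _ := by field_simp
  have hne : ∀ r, (S r).Nonempty := fun r => (hex r).imp fun c hc => hc.1
  refine ⟨fun r => sSup (S r), fun r _ r' _ hr => ?_, fun r _ => ?_, fun e v => ?_⟩
  · exact csSup_le_csSup (hbdd r) (hne r') fun c hc => ⟨hc.1, fun e he => hc.2 e (he.trans hr)⟩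
  · obtain ⟨c, hc, h0⟩ := hex r
    exact h0.trans_le (le_csSup (hbdd r) hc)
  · rcases eq_or_ne v 0 with rfl | hv
    · simp
    · have hn : 0 < ‖v‖ ^ 2 := by positivity
      rw [← le_div_iff₀ hn]
      exact csSup_le (hne _) fun c hc => (le_div_iff₀ hn).2 (hc.2 e le_rfl v)

lemma exists_monotone_upper_bound (H : DecayingFlow F f Φ) (Q : E →L[ℝ] E) :
    ∃ pu : ℝ → ℝ, MonotoneOn pu (Ici 0) ∧
      ∀ e v, ⟪gramian Q Φ e v, v⟫ ≤ pu ‖e‖ * ‖v‖ ^ 2 := by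
  have := FiniteDimensional.proper_real E
  have hc := (H.gramian_integrable_and_continuous Q).2
  have hb : ∀ r, BddAbove ((fun e => ‖gramian Q Φ e‖) '' Metric.closedBall 0 r) := fun r =>
    ((isCompact_closedBall (0 : E) r).image hc.norm).bddAbove
  refine ⟨fun r => sSup ((fun e => ‖gramian Q Φ e‖) '' Metric.closedBall 0 r),
    fun r hr r' _ hrr => ?_, fun e v => ?_⟩
  · exact csSup_le_csSup (hb r') ((Metric.nonempty_closedBall.2 hr).image _)
      (image_mono (Metric.closedBall_subset_closedBall hrr))
  · have h := le_csSup (hb ‖e‖) (mem_image_of_mem _ (show e ∈ Metric.closedBall 0 ‖e‖ by simp))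
    calc _ ≤ ‖gramian Q Φ e v‖ * ‖v‖ := real_inner_le_norm _ _
      _ ≤ ‖gramian Q Φ e‖ * ‖v‖ * ‖v‖ := by
        gcongr; exact ContinuousLinearMap.le_opNorm _ _
      _ = ‖gramian Q Φ e‖ * ‖v‖ ^ 2 := by ring
      _ ≤ _ := by gcongr

open MeasureTheory in
lemma conj_gramian_flow (H : DecayingFlow F f Φ) (Q : E →L[ℝ] E) (e : E) {h : ℝ} (hh : 0 ≤ h) :
    star (Φ e h) * gramian Q Φ (f e h) * Φ e h =
      gramian Q Φ e - ∫ s in (0 : ℝ)..h, adjoint (Φ e s) ∘L Q ∘L Φ e s := by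
  have hi := (H.gramian_integrable_and_continuous Q).1
  rw [gramian, gramian, ← intervalIntegral.integral_Ioi_sub_Ioi (hi e) hh, sub_sub_cancel]
  have h1 := (measurePreserving_add_left volume h).setIntegral_preimage_emb
    (measurableEmbedding_addLeft h) (fun s => adjoint (Φ e s) ∘L Q ∘L Φ e s) (Ioi h)
  have h2 : (fun x => h + x) ⁻¹' Ioi h = Ioi 0 := by
    ext x; simp
  rw [h2] at h1
  rw [← h1]
  have h3 := (ContinuousLinearMap.mulLeftRight ℝ (E →L[ℝ] E) (star (Φ e h))
    (Φ e h)).integral_comp_comm (hi (f e h))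
  simp only [ContinuousLinearMap.mulLeftRight_apply] at h3
  rw [← h3]
  refine setIntegral_congr_fun measurableSet_Ioi fun s hs => ?_
  have ha : Φ (f e h) s * Φ e h = Φ e (h + s) := H.trans_add e hh (le_of_lt hs)
  simp only [← ContinuousLinearMap.star_eq_adjoint]
  change star (Φ e h) * (star (Φ (f e h) s) * (Q * Φ (f e h) s)) * Φ e h =
    star (Φ e (h + s)) * (Q * Φ e (h + s))
  rw [← ha, star_mul]
  simp only [mul_assoc]

lemma hasDerivWithinAt_gramian_flow (H : DecayingFlow F f Φ) (Q : E →L[ℝ] E) (e : E) :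
    HasDerivWithinAt (fun h => gramian Q Φ (f e h))
      (-(adjoint (fderiv ℝ F e) ∘L gramian Q Φ e + gramian Q Φ e ∘L fderiv ℝ F e + Q))
      (Ici 0) 0 := by
  set J : ℝ → E →L[ℝ] E := fun h => Ring.inverse (Φ e h) with hJdef
  have hJ : HasDerivWithinAt J (-fderiv ℝ F e) (Ici 0) 0 := by
    have hΦ := H.trans e 0 le_rfl
    rw [H.init, H.trans_init] at hΦ
    have hinv := hasFDerivAt_ringInverse (𝕜 := ℝ) (1 : (E →L[ℝ] E)ˣ)
    have h0 : ((1 : (E →L[ℝ] E)ˣ) : E →L[ℝ] E) = Φ e 0 := by rw [H.trans_init]; rfl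
    rw [h0] at hinv
    refine (hinv.comp_hasDerivWithinAt 0 hΦ).congr_deriv ?_
    ext v; simp
  have hI := (hasDerivWithinAt_integral_of_continuousOn_Ici
    (H.continuousOn_gramian_integrand Q e) le_rfl).const_sub (gramian Q Φ e)
  have hJ0 : J 0 = 1 := by
    simp only [hJdef, H.trans_init]
    exact Ring.inverse_one _
  have hprod := (hJ.star.mul hI).mul hJ
  have heq : ∀ h, 0 ≤ h → gramian Q Φ (f e h) =
      star (J h) * (gramian Q Φ e - ∫ s in (0 : ℝ)..h, adjoint (Φ e s) ∘L Q ∘L Φ e s) * J h := by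
    intro h hh
    rw [← H.conj_gramian_flow Q e hh]
    have hu : Φ e h * J h = 1 := Ring.mul_inverse_cancel _ (H.isUnit_trans e hh)
    have hu' : star (J h) * star (Φ e h) = 1 := by rw [← star_mul, hu, star_one]
    have hassoc : star (J h) * (star (Φ e h) * gramian Q Φ (f e h) * Φ e h) * J h =
        (star (J h) * star (Φ e h)) * gramian Q Φ (f e h) * (Φ e h * J h) := by
      simp only [mul_assoc]
    rw [hassoc, hu, hu', one_mul, mul_one]
  refine (hprod.congr (fun h hh => heq h hh) (heq 0 le_rfl)).congr_deriv ?_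
  simp only [hJ0, H.trans_init, ← ContinuousLinearMap.star_eq_adjoint]
  have hid : star (ContinuousLinearMap.id ℝ E) = ContinuousLinearMap.id ℝ E :=
    star_one (E →L[ℝ] E)
  ext v
  simp [hJ0, hid]
  abel

lemma contDiff_gramian (H : DecayingFlow F f Φ) {Q : E →L[ℝ] E} (hQ : IsSelfAdjoint Q)
    (m : ℕ) (hF : ContDiff ℝ (m + 2) F) : ContDiff ℝ (m + 1) (gramian Q Φ) := by
  set B : E × E →L[ℝ] E × E →L[ℝ] ℝ := (innerSL ℝ).bilinearComp
    (Q ∘L ContinuousLinearMap.snd ℝ E E) (ContinuousLinearMap.snd ℝ E E) with hB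
  have hF2 : ContDiff ℝ 2 F := hF.of_le le_add_self
  have hq := DecayingFlow.contDiff_quadIntegral m (H.tangent hF2)
    (by exact_mod_cast contDiff_tangentField (m := m + 1) (by exact_mod_cast hF)) B
  have hquad : ∀ e v, quadIntegral B (tangentFlow f Φ) (e, v) = ⟪gramian Q Φ e v, v⟫ := by
    intro e v
    rw [H.inner_gramian]
    simp [quadIntegral, hB, tangentFlow]
  refine contDiff_clm_apply_iff.2 fun v => ?_
  have hw : ∀ w, ContDiff ℝ (m + 1) fun e => ⟪w, gramian Q Φ e v⟫ := by
    intro w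
    have he : (fun e => ⟪w, gramian Q Φ e v⟫) = fun e =>
        (1 / 4 : ℝ) * (quadIntegral B (tangentFlow f Φ) (e, v + w) -
          quadIntegral B (tangentFlow f Φ) (e, v - w)) := by
      funext e
      rw [hquad, hquad, real_inner_comm]
      simp only [map_add, map_sub, inner_add_left, inner_add_right, inner_sub_left,
        inner_sub_right, H.inner_gramian_symm hQ e w v]
      ring
    rw [he]
    exact contDiff_const.mul ((hq.comp (contDiff_id.prodMk contDiff_const)).sub
      (hq.comp (contDiff_id.prodMk contDiff_const)))
  let b := stdOrthonormalBasis ℝ E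
  have hsum : (fun e => gramian Q Φ e v) = fun e => ∑ i, ⟪b i, gramian Q Φ e v⟫ • b i := by
    funext e
    exact (b.sum_repr' _).symm
  rw [hsum]
  exact ContDiff.sum fun i _ => (hw (b i)).smul contDiff_const

end DecayingFlow

end gramian

/-- **Fact 2 for global properties** (Proposition 4): assume
|E(e,t)| ≤ k(|e|) exp(−λ t)|e| and |Φ(e,t)δ| ≤ k̃(|e|) exp(−λ̃ t)|δ| with k, k̃
continuous and strictly increasing and λ, λ̃ > 0.  Then for every symmetric
positive definite Q the function P(e) := lim_{T→∞} ∫₀ᵀ Φ(e,s)ᵀ Q Φ(e,s) ds is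
well defined and continuous, satisfies 0 < p̲(|e|) I ≤ P(e) ≤ p̄(|e|) I with p̲
positive non-increasing and p̄ non-decreasing, has a derivative 𝔡_F P(e) along
the flow satisfying 𝔡_F P(e) + P(e)∂F/∂e(e) + ∂F/∂e(e)ᵀP(e) ≤ −Q, and is C²
whenever F is C³. -/
theorem fact2_global
    {n : ℕ}
    (F : Euc n → Euc n) (hF : ContDiff ℝ 1 F) (hF0 : F 0 = 0)
    (Efl : Euc n → ℝ → Euc n)
    (hinit : ∀ e, Efl e 0 = e)
    (hflow : ∀ e t, 0 ≤ t → HasDerivWithinAt (Efl e) (F (Efl e t)) (Ici 0) t)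
    (Φ : Euc n → ℝ → Euc n →L[ℝ] Euc n)
    (hΦ0 : ∀ e, Φ e 0 = ContinuousLinearMap.id ℝ (Euc n))
    (hΦ : ∀ e t, 0 ≤ t →
      HasDerivWithinAt (Φ e) ((fderiv ℝ F (Efl e t)) ∘L Φ e t) (Ici 0) t)
    -- decay estimates for the flow and for the linearization along solutions
    (k kt : ℝ → ℝ)
    (hkc : ContinuousOn k (Ici 0)) (hkm : StrictMonoOn k (Ici 0))
    (hktc : ContinuousOn kt (Ici 0)) (hktm : StrictMonoOn kt (Ici 0))
    (lam lamt : ℝ) (hlam : 0 < lam) (hlamt : 0 < lamt)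
    (hE : ∀ e t, 0 ≤ t → ‖Efl e t‖ ≤ k ‖e‖ * exp (-lam * t) * ‖e‖)
    (hΦbnd : ∀ (e δ : Euc n) (t : ℝ), 0 ≤ t →
      ‖Φ e t δ‖ ≤ kt ‖e‖ * exp (-lamt * t) * ‖δ‖)
    -- a symmetric positive definite Q
    (Q : Euc n →L[ℝ] Euc n) (hQsa : IsSelfAdjoint Q)
    (hQpos : ∀ v, v ≠ 0 → 0 < ⟪Q v, v⟫) :
    ∃ P : Euc n → Euc n →L[ℝ] Euc n,
      -- P(e) = lim_{T → ∞} ∫₀ᵀ Φ(e,s)ᵀ Q Φ(e,s) ds is well defined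
      (∀ e, Tendsto
        (fun T => ∫ s in (0:ℝ)..T, ContinuousLinearMap.adjoint (Φ e s) ∘L Q ∘L Φ e s)
        atTop (𝓝 (P e))) ∧
      -- P is continuous
      Continuous P ∧
      -- 0 < p̲(|e|) I ≤ P(e) ≤ p̄(|e|) I
      (∃ pl pu : ℝ → ℝ, AntitoneOn pl (Ici 0) ∧ MonotoneOn pu (Ici 0) ∧
        (∀ s, 0 ≤ s → 0 < pl s) ∧
        ∀ (e v : Euc n),
          pl ‖e‖ * ‖v‖ ^ 2 ≤ ⟪P e v, v⟫ ∧ ⟪P e v, v⟫ ≤ pu ‖e‖ * ‖v‖ ^ 2) ∧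
      -- the derivative of P along the flow exists and satisfies the Lyapunov inequality
      (∃ dP : Euc n → Euc n →L[ℝ] Euc n, ∀ e,
        HasDerivWithinAt (fun h => P (Efl e h)) (dP e) (Ici 0) 0 ∧
        ∀ v, ⟪(dP e + P e ∘L fderiv ℝ F e +
          ContinuousLinearMap.adjoint (fderiv ℝ F e) ∘L P e) v, v⟫ ≤ -⟪Q v, v⟫) ∧
      -- if F is C³ then P is C²
      (ContDiff ℝ 3 F → ContDiff ℝ 2 P) := by
  have H : DecayingFlow F Efl Φ := by
    refine ⟨hF, hinit, hflow, hΦ0, hΦ, min lam lamt, lt_min hlam hlamt, fun R => ?_⟩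
    refine ⟨max (k R) 0 * |R| + max (kt R) 0 + 1, by positivity, fun e he t ht => ?_⟩
    have hR : 0 ≤ R := (norm_nonneg e).trans he
    have hk : k ‖e‖ ≤ max (k R) 0 :=
      (hkm.monotoneOn (norm_nonneg e) hR he).trans (le_max_left _ _)
    have hkt : kt ‖e‖ ≤ max (kt R) 0 :=
      (hktm.monotoneOn (norm_nonneg e) hR he).trans (le_max_left _ _)
    have h1 : exp (-lam * t) ≤ exp (-min lam lamt * t) :=
      exp_le_exp.2 (by nlinarith [min_le_left lam lamt])
    have h2 : exp (-lamt * t) ≤ exp (-min lam lamt * t) :=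
      exp_le_exp.2 (by nlinarith [min_le_right lam lamt])
    have hx : 0 ≤ max (k R) 0 * |R| := by positivity
    have hy : 0 ≤ max (kt R) 0 := le_max_right _ _
    constructor
    · calc _ ≤ k ‖e‖ * exp (-lam * t) * ‖e‖ := hE e t ht
        _ ≤ max (k R) 0 * exp (-min lam lamt * t) * |R| := by
          gcongr
          exact he.trans (le_abs_self R)
        _ = max (k R) 0 * |R| * exp (-min lam lamt * t) := by ring
        _ ≤ _ := by gcongr; linarith
    · refine ContinuousLinearMap.opNorm_le_bound _ (by positivity) fun δ => ?_
      calc _ ≤ kt ‖e‖ * exp (-lamt * t) * ‖δ‖ := hΦbnd e δ t ht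
        _ ≤ max (kt R) 0 * exp (-min lam lamt * t) * ‖δ‖ := by gcongr
        _ ≤ _ := by gcongr; linarith
  obtain ⟨hint, hcont⟩ := H.gramian_integrable_and_continuous Q
  obtain ⟨pl, hpl, hpl0, hle⟩ := H.exists_antitone_lower_bound hQpos
  obtain ⟨pu, hpu, hge⟩ := H.exists_monotone_upper_bound Q
  refine ⟨gramian Q Φ, fun e => ?_, hcont,
    ⟨pl, pu, hpl, hpu, hpl0, fun e v => ⟨hle e v, hge e v⟩⟩,
    ⟨_, fun e => ⟨H.hasDerivWithinAt_gramian_flow Q e, fun v => ?_⟩⟩, fun hF3 => ?_⟩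
  · exact MeasureTheory.intervalIntegral_tendsto_integral_Ioi 0 (hint e) tendsto_id
  · refine le_of_eq ?_
    rw [← inner_neg_left]
    congr 1
    simp only [add_apply, neg_apply, ContinuousLinearMap.comp_apply]
    abel
  · have h := H.contDiff_gramian hQsa 1 (by norm_num; exact hF3)
    norm_num at h
    exact h
end

section
/- Consider the controlled system ẇ = f(w) + g(w)u on ℝ^{n} with f, g smooth vector fields and scalar control u. Assume there is a C³ symmetric-matrix-valued P : ℝ^{n} → ℝ^{n×n} such that: (1) there exist a positive non-increasing function p̲ and a non-decreasing function p̄ with p̲(|w|) I ≤ P(w) ≤ p̄(|w|) I for all w and lim_{r→∞} p̲(r) r² = +∞, and there exist λ > 0 and a symmetric positive definite matrix Q with 𝔡_f P(w) + P(w)(∂f/∂w)(w) + (∂f/∂w)(w)ᵀ P(w) − λ P(w) g(w) g(w)ᵀ P(w) ≤ −Q for all w; (2) g is a Killing vector field for P, i.e. L_g P(w) := 𝔡_g P(w) + P(w)(∂g/∂w)(w) + (∂g/∂w)(w)ᵀ P(w) = 0 for all w; (3) there exists a C¹ function U : ℝ^{n} → ℝ with (∂U/∂w)(w) = (P(w)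 g(w))ᵀ for all w; and the origin is an equilibrium of the closed-loop vector field F(w) := f(w) − λ g(w) U(w). Then the closed-loop system ẇ = f(w) − λ g(w) U(w) satisfies L_F P(w) ≤ −Q for all w, and its origin is locally exponentially stable and globally attractive. -/
open Real Set Filter
open scoped RealInnerProductSpace Topology

namespace RiemannianStabilization

variable {E : Type*} [NormedAddCommGroup E] [InnerProductSpace ℝ E]

/-- A `C¹` field of bilinear forms bounded below by a positive, radially non-increasing function
`p` with `p r * r ^ 2 → ∞`. -/
structure IsProperMetric (P : E → E →L[ℝ] E) (p : ℝ → ℝ) : Prop where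
  contDiff : ContDiff ℝ 1 P
  pos : ∀ s, 0 ≤ s → 0 < p s
  anti : AntitoneOn p (Ici 0)
  lower : ∀ w v : E, p ‖w‖ * ‖v‖ ^ 2 ≤ ⟪P w v, v⟫
  proper : Tendsto (fun r => p r * r ^ 2) atTop atTop

/-- The energy of the curve `γ` on `[0, 1]` for the metric `P`. -/
noncomputable def pathEnergy (P : E → E →L[ℝ] E) (γ : ℝ → E) : ℝ :=
  ∫ s in (0 : ℝ)..1, ⟪P (γ s) (deriv γ s), deriv γ s⟫

/-- The `C¹` curves joining the origin to `x`. -/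
def pathsTo (x : E) : Set (ℝ → E) := {γ | ContDiff ℝ 1 γ ∧ γ 0 = 0 ∧ γ 1 = x}

/-- The infimum of the energies of the `C¹` curves joining the origin to `x`. -/
noncomputable def minEnergy (P : E → E →L[ℝ] E) (x : E) : ℝ :=
  sInf (pathEnergy P '' pathsTo x)

variable {P : E → E →L[ℝ] E} {p : ℝ → ℝ} {γ : ℝ → E} {x : E}

lemma continuous_energyDensity (hP : Continuous P) (hγ : ContDiff ℝ 1 γ) :
    Continuous fun s => ⟪P (γ s) (deriv γ s), deriv γ s⟫ := by
  have h1 : Continuous γ := hγ.continuous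
  have h2 : Continuous (deriv γ) := hγ.continuous_deriv le_rfl
  fun_prop

lemma IsProperMetric.nonneg (hP : IsProperMetric P p) (w v : E) : 0 ≤ ⟪P w v, v⟫ :=
  le_trans (mul_nonneg (hP.pos _ (norm_nonneg _)).le (sq_nonneg _)) (hP.lower w v)

lemma IsProperMetric.lower_of_norm_le (hP : IsProperMetric P p) {R : ℝ} {w : E}
    (hw : ‖w‖ ≤ R) (v : E) : p R * ‖v‖ ^ 2 ≤ ⟪P w v, v⟫ := by
  refine le_trans (mul_le_mul_of_nonneg_right ?_ (sq_nonneg _)) (hP.lower w v)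
  exact hP.anti (norm_nonneg w) ((norm_nonneg w).trans hw) hw

lemma IsProperMetric.pathEnergy_nonneg (hP : IsProperMetric P p) (γ : ℝ → E) :
    0 ≤ pathEnergy P γ :=
  intervalIntegral.integral_nonneg zero_le_one fun _ _ => hP.nonneg _ _

lemma sq_norm_le_integral_sq_norm_deriv [CompleteSpace E] (hγ : ContDiff ℝ 1 γ) (h0 : γ 0 = 0)
    {s : ℝ} (hs : s ∈ Icc (0 : ℝ) 1) :
    ‖γ s‖ ^ 2 ≤ ∫ t in (0 : ℝ)..1, ‖deriv γ t‖ ^ 2 := by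
  have hc : Continuous (deriv γ) := hγ.continuous_deriv le_rfl
  have h1 : γ s = ∫ t in (0 : ℝ)..s, deriv γ t := by
    rw [intervalIntegral.integral_deriv_eq_sub
      (fun t _ => (hγ.differentiable one_ne_zero).differentiableAt)
      (hc.intervalIntegrable _ _), h0, sub_zero]
  have h2 : ‖γ s‖ ≤ ∫ t in (0 : ℝ)..s, ‖deriv γ t‖ := by
    rw [h1]
    exact intervalIntegral.norm_integral_le_integral_norm hs.1
  have h3 : (∫ t in (0 : ℝ)..s, 2 * ‖γ s‖ * ‖deriv γ t‖) ≤
      ∫ t in (0 : ℝ)..s, (‖deriv γ t‖ ^ 2 + ‖γ s‖ ^ 2) := by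
    refine intervalIntegral.integral_mono_on hs.1
      (Continuous.intervalIntegrable (by fun_prop) _ _)
      (Continuous.intervalIntegrable (by fun_prop) _ _) fun t _ => ?_
    nlinarith [sq_nonneg (‖deriv γ t‖ - ‖γ s‖)]
  rw [intervalIntegral.integral_const_mul, intervalIntegral.integral_add
    (Continuous.intervalIntegrable (by fun_prop) _ _)
    (Continuous.intervalIntegrable (by fun_prop) _ _), intervalIntegral.integral_const,
    sub_zero, smul_eq_mul] at h3
  have h4 : (∫ t in (0 : ℝ)..s, ‖deriv γ t‖ ^ 2) ≤ ∫ t in (0 : ℝ)..1, ‖deriv γ t‖ ^ 2 :=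
    intervalIntegral.integral_mono_interval le_rfl hs.1 hs.2
      (Eventually.of_forall fun t => sq_nonneg _)
      (Continuous.intervalIntegrable (by fun_prop) _ _)
  nlinarith [mul_le_mul_of_nonneg_left h2 (norm_nonneg (γ s)), hs.2, sq_nonneg ‖γ s‖]

lemma IsProperMetric.mul_sq_norm_le_pathEnergy [CompleteSpace E] (hP : IsProperMetric P p)
    (hγ : ContDiff ℝ 1 γ) (h0 : γ 0 = 0) {R : ℝ} (hR : ∀ t ∈ Icc (0 : ℝ) 1, ‖γ t‖ ≤ R)
    {s : ℝ} (hs : s ∈ Icc (0 : ℝ) 1) : p R * ‖γ s‖ ^ 2 ≤ pathEnergy P γ := by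
  have hR0 : 0 ≤ R := (norm_nonneg _).trans (hR s hs)
  have hc : Continuous (deriv γ) := hγ.continuous_deriv le_rfl
  refine (mul_le_mul_of_nonneg_left (sq_norm_le_integral_sq_norm_deriv hγ h0 hs)
    (hP.pos R hR0).le).trans ?_
  rw [← intervalIntegral.integral_const_mul]
  exact intervalIntegral.integral_mono_on zero_le_one
    (Continuous.intervalIntegrable (by fun_prop) _ _)
    ((continuous_energyDensity hP.contDiff.continuous hγ).intervalIntegrable _ _)
    fun t ht => hP.lower_of_norm_le (hR t ht) _

/-- Curves of bounded energy issued from the origin stay in a common ball. -/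
lemma IsProperMetric.exists_radius [CompleteSpace E] (hP : IsProperMetric P p) (M : ℝ) :
    ∃ R, 0 < R ∧ ∀ γ : ℝ → E, ContDiff ℝ 1 γ → γ 0 = 0 → pathEnergy P γ ≤ M →
      ∀ s ∈ Icc (0 : ℝ) 1, ‖γ s‖ ≤ R := by
  obtain ⟨R, hR⟩ := eventually_atTop.1 (hP.proper.eventually_gt_atTop M)
  refine ⟨max R 1, by positivity, fun γ hγ h0 hE s hs => ?_⟩
  obtain ⟨t, ht, hmax⟩ := isCompact_Icc.exists_isMaxOn (nonempty_Icc.2 zero_le_one)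
    (hγ.continuous.norm.continuousOn (s := Icc (0 : ℝ) 1))
  by_contra! hlt
  have h1 : max R 1 < ‖γ t‖ := hlt.trans_le (hmax hs)
  have h2 := hR ‖γ t‖ ((le_max_left _ _).trans h1.le)
  have h3 := hP.mul_sq_norm_le_pathEnergy hγ h0 (fun s hs => hmax hs) ht
  linarith

lemma smul_mem_pathsTo (x : E) : (fun s : ℝ => s • x) ∈ pathsTo x :=
  ⟨by fun_prop, by simp, by simp⟩

lemma IsProperMetric.minEnergy_le (hP : IsProperMetric P p) (hγ : γ ∈ pathsTo x) :
    minEnergy P x ≤ pathEnergy P γ :=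
  csInf_le ⟨0, by rintro _ ⟨γ, -, rfl⟩; exact hP.pathEnergy_nonneg γ⟩ ⟨γ, hγ, rfl⟩

lemma IsProperMetric.minEnergy_nonneg (hP : IsProperMetric P p) (x : E) : 0 ≤ minEnergy P x :=
  Real.sInf_nonneg (by rintro _ ⟨γ, -, rfl⟩; exact hP.pathEnergy_nonneg γ)

lemma exists_pathEnergy_lt {a : ℝ} (h : minEnergy P x < a) :
    ∃ γ ∈ pathsTo x, pathEnergy P γ < a := by
  obtain ⟨_, ⟨γ, hγ, rfl⟩, h⟩ :=
    exists_lt_of_csInf_lt (Set.Nonempty.image _ ⟨_, smul_mem_pathsTo x⟩) h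
  exact ⟨γ, hγ, h⟩

/-- To compare values of `minEnergy`, it suffices to compare near-minimal curves. -/
lemma IsProperMetric.minEnergy_le_of_forall_path (hP : IsProperMetric P p) {M a b : ℝ} {y : E}
    (hx : minEnergy P x ≤ M)
    (h : ∀ γ ∈ pathsTo x, pathEnergy P γ ≤ M + 1 → minEnergy P y ≤ a * pathEnergy P γ + b) :
    minEnergy P y ≤ a * minEnergy P x + b := by
  refine le_of_forall_pos_le_add fun ε hε => ?_
  set θ := min 1 (ε / (|a| + 1)) with hθ
  have hθ0 : 0 < θ := by positivity
  obtain ⟨γ, hγ, hlt⟩ := exists_pathEnergy_lt (lt_add_of_pos_right (minEnergy P x) hθ0)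
  have h1 := hP.minEnergy_le hγ
  have h2 := h γ hγ (by linarith [min_le_left 1 (ε / (|a| + 1))])
  have h3 : a * (pathEnergy P γ - minEnergy P x) ≤ |a| * θ := by
    exact mul_le_mul (le_abs_self a) (by linarith) (by linarith) (abs_nonneg a)
  have h4 : (|a| + 1) * θ ≤ ε := by
    rw [mul_comm, ← le_div_iff₀ (by positivity)]
    exact min_le_right _ _
  linarith

lemma IsProperMetric.minEnergy_le_of_upper (hP : IsProperMetric P p) {q : ℝ → ℝ}
    (hq : MonotoneOn q (Ici 0)) (hup : ∀ w v : E, ⟪P w v, v⟫ ≤ q ‖w‖ * ‖v‖ ^ 2) (x : E) :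
    minEnergy P x ≤ q ‖x‖ * ‖x‖ ^ 2 := by
  refine (hP.minEnergy_le (smul_mem_pathsTo x)).trans ?_
  have hd : deriv (fun s : ℝ => s • x) = fun _ => x := by
    ext1 s
    simpa using ((hasDerivAt_id s).smul_const x).deriv
  have h : ∫ _ in (0 : ℝ)..1, q ‖x‖ * ‖x‖ ^ 2 = q ‖x‖ * ‖x‖ ^ 2 := by simp
  rw [← h]
  refine intervalIntegral.integral_mono_on zero_le_one
    ((continuous_energyDensity hP.contDiff.continuous (smul_mem_pathsTo x).1).intervalIntegrable
      _ _) (Continuous.intervalIntegrable (by fun_prop) _ _) fun s hs => ?_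
  rw [hd]
  refine (hup _ _).trans (mul_le_mul_of_nonneg_right ?_ (sq_nonneg _))
  refine hq (norm_nonneg _) (norm_nonneg _) ?_
  rw [norm_smul, Real.norm_of_nonneg hs.1]
  exact mul_le_of_le_one_left (norm_nonneg _) hs.2

lemma IsProperMetric.exists_mul_sq_norm_le_minEnergy [CompleteSpace E] (hP : IsProperMetric P p)
    (M : ℝ) : ∃ c, 0 < c ∧ ∀ x, minEnergy P x ≤ M → c * ‖x‖ ^ 2 ≤ minEnergy P x := by
  obtain ⟨R, hR, hball⟩ := hP.exists_radius (M + 1)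
  refine ⟨p R, hP.pos R hR.le, fun x hx => ?_⟩
  refine le_of_forall_gt_imp_ge_of_dense fun a ha => ?_
  obtain ⟨γ, ⟨hγ, h0, h1⟩, hlt⟩ := exists_pathEnergy_lt (lt_min ha (by linarith : _ < M + 1))
  have h := hP.mul_sq_norm_le_pathEnergy hγ h0
    (hball γ hγ h0 (hlt.le.trans (min_le_right _ _))) (right_mem_Icc.2 zero_le_one)
  rw [h1] at h
  exact h.trans (hlt.le.trans (min_le_left _ _))

/-- If `w ↦ P w` is `K`-bounded and `K`-Lipschitz near a segment, the quadratic form changes little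
under small perturbations of the base point and of the vector. -/
lemma inner_perturb_le {A B : E →L[ℝ] E} {K c d : ℝ} (hc : 0 < c) (hd1 : d ≤ 1)
    (hB : ‖B‖ ≤ K) (hAB : ‖B - A‖ ≤ K * d) {v δ : E} (hδ : ‖δ‖ = d)
    (hA : c * ‖v‖ ^ 2 ≤ ⟪A v, v⟫) :
    ⟪B (v + δ), v + δ⟫ ≤ (1 + 2 * K / c * d) * ⟪A v, v⟫ + 3 * K * d := by
  have hd : 0 ≤ d := hδ ▸ norm_nonneg δ
  have hK : 0 ≤ K := (norm_nonneg B).trans hB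
  have bound : ∀ (T : E →L[ℝ] E) (k : ℝ), ‖T‖ ≤ k → ∀ y z : E, ⟪T y, z⟫ ≤ k * ‖y‖ * ‖z‖ := by
    intro T k hT y z
    refine (real_inner_le_norm _ _).trans ?_
    gcongr
    exact T.le_of_opNorm_le hT y
  have e : ⟪B (v + δ), v + δ⟫ =
      ⟪A v, v⟫ + ⟪(B - A) v, v⟫ + ⟪B v, δ⟫ + ⟪B δ, v⟫ + ⟪B δ, δ⟫ := by
    simp only [map_add, inner_add_left, inner_add_right, _root_.sub_apply,
      inner_sub_left]
    ring
  have b1 := bound _ _ hAB v v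
  have b2 := bound _ _ hB v δ
  have b3 := bound _ _ hB δ v
  have b4 := bound _ _ hB δ δ
  rw [hδ] at b2 b3 b4
  have b5 : K * d * (2 * ‖v‖) ≤ K * d * (‖v‖ ^ 2 + 1) := by
    gcongr
    nlinarith [sq_nonneg (‖v‖ - 1)]
  have b6 : K * d * d ≤ K * d * 1 := by gcongr
  have b7 : 2 * K / c * d * (c * ‖v‖ ^ 2) ≤ 2 * K / c * d * ⟪A v, v⟫ := by gcongr
  have b8 : 2 * K / c * d * (c * ‖v‖ ^ 2) = 2 * K * d * ‖v‖ ^ 2 := by field_simp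
  rw [e]
  nlinarith [mul_nonneg hK hd]

lemma exists_norm_le_and_lipschitz [FiniteDimensional ℝ E] (hP : ContDiff ℝ 1 P) (R : ℝ) :
    ∃ K, 0 ≤ K ∧ (∀ w : E, ‖w‖ ≤ R → ‖P w‖ ≤ K) ∧
      ∀ w z : E, ‖w‖ ≤ R → ‖z‖ ≤ R → ‖P z - P w‖ ≤ K * ‖z - w‖ := by
  obtain ⟨K₁, h₁⟩ := (isCompact_closedBall (0 : E) R).exists_bound_of_continuousOn
    hP.continuous.continuousOn
  obtain ⟨K₂, h₂⟩ := (isCompact_closedBall (0 : E) R).exists_bound_of_continuousOn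
    (hP.continuous_fderiv one_ne_zero).continuousOn
  refine ⟨max 0 (max K₁ K₂), le_max_left _ _, fun w hw => ?_, fun w z hw hz => ?_⟩
  · exact (h₁ w (by simpa using hw)).trans ((le_max_left _ _).trans (le_max_right _ _))
  · exact (convex_closedBall (0 : E) R).norm_image_sub_le_of_norm_fderiv_le (𝕜 := ℝ)
      (fun y _ => (hP.differentiable one_ne_zero).differentiableAt)
      (fun y hy => (h₂ y hy).trans ((le_max_right _ _).trans (le_max_right _ _)))
      (by simpa using hw) (by simpa using hz)

/-- `minEnergy` is Lipschitz at unit scale on its sublevel sets. -/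
lemma IsProperMetric.exists_minEnergy_add_le [FiniteDimensional ℝ E] (hP : IsProperMetric P p)
    (M : ℝ) : ∃ C, 0 ≤ C ∧ ∀ x δ : E, minEnergy P x ≤ M → ‖δ‖ ≤ 1 →
      minEnergy P (x + δ) ≤ minEnergy P x + C * ‖δ‖ := by
  obtain ⟨R, hR, hball⟩ := hP.exists_radius (M + 1)
  obtain ⟨K, hK, hbd, hlip⟩ := exists_norm_le_and_lipschitz hP.contDiff (R + 1)
  have hc : 0 < p R := hP.pos R hR.le
  have hpath : ∀ x δ : E, minEnergy P x ≤ M → ‖δ‖ ≤ 1 →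
      minEnergy P (x + δ) ≤ (1 + 2 * K / p R * ‖δ‖) * minEnergy P x + 3 * K * ‖δ‖ := by
    intro x δ hx hδ
    refine hP.minEnergy_le_of_forall_path hx fun γ ⟨hγ, h0, h1⟩ hE => ?_
    have hγR := hball γ hγ h0 hE
    have hγ' : (fun s : ℝ => γ s + s • δ) ∈ pathsTo (x + δ) :=
      ⟨by fun_prop, by simp [h0], by simp [h1]⟩
    refine (hP.minEnergy_le hγ').trans ?_
    have hd : deriv (fun s : ℝ => γ s + s • δ) = fun s => deriv γ s + δ := by
      ext1 s
      have := (((hγ.differentiable one_ne_zero) s).hasDerivAt.add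
        ((hasDerivAt_id s).smul_const δ)).deriv
      rw [one_smul] at this
      exact this
    have hint := (continuous_energyDensity hP.contDiff.continuous hγ).intervalIntegrable
      (μ := MeasureTheory.volume) 0 1
    have e : (1 + 2 * K / p R * ‖δ‖) * pathEnergy P γ + 3 * K * ‖δ‖ =
        ∫ s in (0 : ℝ)..1, ((1 + 2 * K / p R * ‖δ‖) * ⟪P (γ s) (deriv γ s), deriv γ s⟫ +
          3 * K * ‖δ‖) := by
      rw [intervalIntegral.integral_add (hint.const_mul _)
        (Continuous.intervalIntegrable (by fun_prop) _ _),
        intervalIntegral.integral_const_mul]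
      simp [pathEnergy]
    rw [e]
    refine intervalIntegral.integral_mono_on zero_le_one
      ((continuous_energyDensity hP.contDiff.continuous hγ'.1).intervalIntegrable _ _)
      ((hint.const_mul _).add (Continuous.intervalIntegrable (by fun_prop) _ _)) fun s hs => ?_
    rw [hd]
    have hsδ : ‖s • δ‖ ≤ ‖δ‖ := by
      rw [norm_smul, Real.norm_of_nonneg hs.1]
      exact mul_le_of_le_one_left (norm_nonneg _) hs.2
    have hn : ‖γ s + s • δ‖ ≤ R + 1 :=
      (norm_add_le _ _).trans (add_le_add (hγR s hs) (hsδ.trans hδ))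
    refine inner_perturb_le hc hδ (hbd _ hn) ?_ rfl (hP.lower_of_norm_le (hγR s hs) _)
    refine (hlip _ _ ((hγR s hs).trans (by linarith)) hn).trans ?_
    rw [add_sub_cancel_left]
    gcongr
  refine ⟨2 * K / p R * |M| + 3 * K, by positivity, fun x δ hx hδ => (hpath x δ hx hδ).trans ?_⟩
  have : 2 * K / p R * ‖δ‖ * minEnergy P x ≤ 2 * K / p R * ‖δ‖ * |M| := by
    gcongr
    exact hx.trans (le_abs_self M)
  linarith

lemma IsProperMetric.continuous_minEnergy [FiniteDimensional ℝ E] (hP : IsProperMetric P p) :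
    Continuous (minEnergy P) := by
  refine continuous_iff_continuousAt.2 fun x => ?_
  obtain ⟨C₀, hC₀, h₀⟩ := hP.exists_minEnergy_add_le (minEnergy P x)
  obtain ⟨C, hC, h⟩ := hP.exists_minEnergy_add_le (minEnergy P x + C₀)
  have hlim : Tendsto (fun y => C * ‖y - x‖) (𝓝 x) (𝓝 0) := by
    have : Continuous fun y => C * ‖y - x‖ := by fun_prop
    simpa using this.tendsto x
  refine tendsto_iff_norm_sub_tendsto_zero.2 (squeeze_zero' (Eventually.of_forall fun _ =>
    norm_nonneg _) ?_ hlim)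
  filter_upwards [Metric.closedBall_mem_nhds x one_pos] with y hy
  have hy1 : ‖y - x‖ ≤ 1 := by simpa [dist_eq_norm] using hy
  have hxy : ‖x - y‖ = ‖y - x‖ := norm_sub_rev x y
  have h1 : minEnergy P y ≤ minEnergy P x + C₀ := by
    have := h₀ x (y - x) le_rfl hy1
    rw [add_sub_cancel] at this
    nlinarith
  have h2 := h x (y - x) (by linarith) hy1
  have h3 := h y (x - y) h1 (hxy ▸ hy1)
  rw [add_sub_cancel] at h2 h3
  rw [hxy] at h3
  rw [Real.norm_eq_abs, abs_le]
  constructor <;> linarith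

/-- One explicit Euler step along `F` contracts the metric at a uniform rate on a ball. -/
lemma exists_euler_contraction [FiniteDimensional ℝ E] (hP : ContDiff ℝ 1 P) {F : E → E}
    (hF : ContDiff ℝ 1 F)
    (hneg : ∀ w v : E, v ≠ 0 → ⟪fderiv ℝ P w (F w) v, v⟫ + ⟪P w (fderiv ℝ F w v), v⟫ +
      ⟪P w v, fderiv ℝ F w v⟫ < 0) (R : ℝ) :
    ∃ c, 0 < c ∧ ∀ w v : E, ‖w‖ ≤ R → ∀ h ∈ Icc 0 c,
      ⟪P (w + h • F w) (v + h • fderiv ℝ F w v), v + h • fderiv ℝ F w v⟫ ≤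
        (1 - c * h) * ⟪P w v, v⟫ := by
  have hPc := hP.continuous
  have hP' := hP.continuous_fderiv one_ne_zero
  have hFc := hF.continuous
  have hF' := hF.continuous_fderiv one_ne_zero
  set D : ℝ → E → E → ℝ := fun h w v =>
    ⟪fderiv ℝ P (w + h • F w) (F w) (v + h • fderiv ℝ F w v), v + h • fderiv ℝ F w v⟫ +
    ⟪P (w + h • F w) (fderiv ℝ F w v), v + h • fderiv ℝ F w v⟫ +
    ⟪P (w + h • F w) (v + h • fderiv ℝ F w v), fderiv ℝ F w v⟫ with hD
  have hK : IsCompact (Metric.closedBall (0 : E) R ×ˢ Metric.sphere (0 : E) 1) :=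
    (isCompact_closedBall _ _).prod (isCompact_sphere _ _)
  have hcont : Continuous fun z : (ℝ × ℝ) × (E × E) =>
      D z.1.1 z.2.1 z.2.2 + z.1.2 * ⟪P z.2.1 z.2.2, z.2.2⟫ := by
    simp only [hD]
    fun_prop
  have hev : ∀ᶠ a : ℝ × ℝ in 𝓝 (0, 0), ∀ y ∈ Metric.closedBall (0 : E) R ×ˢ
      Metric.sphere (0 : E) 1, D a.1 y.1 y.2 + a.2 * ⟪P y.1 y.2, y.2⟫ < 0 := by
    refine hK.eventually_forall_of_forall_eventually fun y hy => ?_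
    refine hcont.continuousAt.eventually_lt continuousAt_const ?_
    have hy2 : y.2 ≠ 0 := by
      intro h0
      have := hy.2
      simp [h0] at this
    simpa [hD] using hneg y.1 y.2 hy2
  obtain ⟨ε, hε, hball⟩ := Metric.eventually_nhds_iff.1 hev
  refine ⟨ε / 2, half_pos hε, fun w v hw h hh => ?_⟩
  have hDle : ∀ t ∈ Icc 0 (ε / 2), D t w v ≤ -(ε / 2 * ⟪P w v, v⟫) := by
    intro t ht
    rcases eq_or_ne v 0 with rfl | hv
    · simp [hD]
    have hn : 0 < ‖v‖ := norm_pos_iff.2 hv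
    have h1 := hball (y := (t, ε / 2)) (by
      rw [Prod.dist_eq, max_lt_iff]
      simp only [Real.dist_eq, sub_zero]
      rw [abs_of_nonneg ht.1, abs_of_pos (half_pos hε)]
      exact ⟨by linarith [ht.2], by linarith⟩) (w, ‖v‖⁻¹ • v)
      ⟨by simpa using hw, by simp [norm_smul, hn.ne']⟩
    have h2 : D t w (‖v‖⁻¹ • v) = ‖v‖⁻¹ ^ 2 * D t w v := by
      have e : ‖v‖⁻¹ • v + t • ‖v‖⁻¹ • fderiv ℝ F w v =
          ‖v‖⁻¹ • (v + t • fderiv ℝ F w v) := by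
        rw [smul_add, smul_comm]
      simp only [hD, map_smul, e, inner_smul_left, inner_smul_right]
      simp
      ring
    simp only [h2, map_smul, real_inner_smul_left, real_inner_smul_right] at h1
    have h3 : 0 < ‖v‖⁻¹ ^ 2 := by positivity
    by_contra! hcon
    nlinarith [mul_pos h3 (sub_pos.2 hcon)]
  have hder : ∀ t : ℝ, HasDerivAt (fun t => ⟪P (w + t • F w) (v + t • fderiv ℝ F w v),
      v + t • fderiv ℝ F w v⟫) (D t w v) t := by
    intro t
    have k1 : HasDerivAt (fun t : ℝ => w + t • F w) (F w) t := by
      simpa using ((hasDerivAt_id t).smul_const (F w)).const_add w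
    have k2 : HasDerivAt (fun t : ℝ => v + t • fderiv ℝ F w v) (fderiv ℝ F w v) t := by
      simpa using ((hasDerivAt_id t).smul_const (fderiv ℝ F w v)).const_add v
    have k3 : HasDerivAt (fun t : ℝ => P (w + t • F w)) (fderiv ℝ P (w + t • F w) (F w)) t :=
      ((hP.differentiable one_ne_zero) _).hasFDerivAt.comp_hasDerivAt t k1
    have k4 := (k3.clm_apply k2).inner ℝ k2
    refine k4.congr_deriv ?_
    simp only [hD, inner_add_left]
    ring
  have hmv := (convex_Icc 0 (ε / 2)).image_sub_le_mul_sub_of_deriv_le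
    (fun t _ => (hder t).continuousAt.continuousWithinAt)
    (fun t _ => (hder t).differentiableAt.differentiableWithinAt)
    (C := -(ε / 2 * ⟪P w v, v⟫))
    (fun t ht => (hder t).deriv.le.trans (hDle t (interior_subset ht)))
    0 (left_mem_Icc.2 (half_pos hε).le) h hh hh.1
  simp only [zero_smul, add_zero, sub_zero] at hmv
  linarith

/-- One explicit Euler step along `F` decreases `minEnergy` at a uniform rate on sublevel sets. -/
lemma IsProperMetric.exists_minEnergy_euler_le [FiniteDimensional ℝ E] (hP : IsProperMetric P p)
    {F : E → E} (hF : ContDiff ℝ 1 F) (hF0 : F 0 = 0)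
    (hneg : ∀ w v : E, v ≠ 0 → ⟪fderiv ℝ P w (F w) v, v⟫ + ⟪P w (fderiv ℝ F w v), v⟫ +
      ⟪P w v, fderiv ℝ F w v⟫ < 0) (M : ℝ) :
    ∃ c, 0 < c ∧ ∀ x, minEnergy P x ≤ M → ∀ h ∈ Icc 0 c,
      minEnergy P (x + h • F x) ≤ (1 - c * h) * minEnergy P x := by
  obtain ⟨R, hR, hball⟩ := hP.exists_radius (M + 1)
  obtain ⟨c, hc, hstep⟩ := exists_euler_contraction hP.contDiff hF hneg R
  refine ⟨c, hc, fun x hx h hh => ?_⟩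
  rw [← add_zero ((1 - c * h) * minEnergy P x)]
  refine hP.minEnergy_le_of_forall_path hx fun γ ⟨hγ, h0, h1⟩ hE => ?_
  have hγR := hball γ hγ h0 hE
  have hγ' : (fun s : ℝ => γ s + h • F (γ s)) ∈ pathsTo (x + h • F x) :=
    ⟨by fun_prop, by simp [h0, hF0], by simp [h1]⟩
  refine (hP.minEnergy_le hγ').trans ?_
  have hd : deriv (fun s : ℝ => γ s + h • F (γ s)) =
      fun s => deriv γ s + h • fderiv ℝ F (γ s) (deriv γ s) := by
    ext1 s
    have k := ((hγ.differentiable one_ne_zero) s).hasDerivAt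
    exact (k.add ((((hF.differentiable one_ne_zero) (γ s)).hasFDerivAt.comp_hasDerivAt s
      k).const_smul h)).deriv
  rw [add_zero, pathEnergy, pathEnergy, ← intervalIntegral.integral_const_mul]
  refine intervalIntegral.integral_mono_on zero_le_one
    ((continuous_energyDensity hP.contDiff.continuous hγ'.1).intervalIntegrable _ _)
    (((continuous_energyDensity hP.contDiff.continuous hγ).intervalIntegrable _ _).const_mul _)
    fun s hs => ?_
  rw [hd]
  exact hstep _ _ (hγR s hs) h hh

/-- Grönwall estimate for `minEnergy` along a trajectory staying in a sublevel set on which Euler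
steps contract. -/
lemma IsProperMetric.minEnergy_le_exp [FiniteDimensional ℝ E] (hP : IsProperMetric P p)
    {F : E → E} {M c T : ℝ} (hc : 0 < c)
    (hstep : ∀ x, minEnergy P x ≤ M → ∀ h ∈ Icc 0 c,
      minEnergy P (x + h • F x) ≤ (1 - c * h) * minEnergy P x)
    {W : ℝ → E} (hW : ∀ t, 0 ≤ t → HasDerivWithinAt W (F (W t)) (Ici 0) t) (hT : 0 ≤ T)
    (hM : ∀ t ∈ Icc 0 T, minEnergy P (W t) ≤ M) :
    minEnergy P (W T) ≤ minEnergy P (W 0) * exp (-c * T) := by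
  obtain ⟨C, hC, hlip⟩ := hP.exists_minEnergy_add_le M
  have hWc : ContinuousOn W (Icc 0 T) := fun t ht =>
    (hW t ht.1).continuousWithinAt.mono Icc_subset_Ici_self
  have key := le_gronwallBound_of_liminf_deriv_right_le (f := fun t => minEnergy P (W t))
    (f' := fun t => -c * minEnergy P (W t)) (δ := minEnergy P (W 0)) (K := -c) (ε := 0)
    (a := 0) (b := T) (hP.continuous_minEnergy.comp_continuousOn hWc) ?_ le_rfl
    (fun t _ => by simp) T (right_mem_Icc.2 hT)
  · simpa [gronwallBound_ε0] using key
  intro t ht r hr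
  refine Eventually.frequently ?_
  have hx : minEnergy P (W t) ≤ M := hM t (Ico_subset_Icc_self ht)
  have hder : HasDerivWithinAt W (F (W t)) (Ioi t) t :=
    (hW t ht.1).mono fun s hs => ht.1.trans (le_of_lt hs)
  have hslope := hasDerivWithinAt_iff_tendsto_slope' (by simp) |>.1 hder
  set η := (r + c * minEnergy P (W t)) / (C + 1) with hη
  have hη0 : 0 < η := div_pos (by linarith) (by linarith)
  have hev := hslope.eventually (Metric.ball_mem_nhds (F (W t)) (lt_min hη0 one_pos))
  have hm : 0 < min c 1 := lt_min hc one_pos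
  filter_upwards [hev, self_mem_nhdsWithin,
    nhdsWithin_le_nhds (Iio_mem_nhds (show t < t + min c 1 by linarith))] with z hz hz1 hz2
  have hh : 0 < z - t := sub_pos.2 hz1
  have hhc : z - t ≤ min c 1 := by linarith [mem_Iio.1 hz2]
  set h := z - t with hh_def
  set δ := W z - (W t + h • F (W t)) with hδ
  have hslope_eq : δ = h • (slope W t z - F (W t)) := by
    rw [slope_def_module, smul_sub, smul_inv_smul₀ hh.ne', hδ]
    abel
  have hδn : ‖δ‖ ≤ h * min η 1 := by
    rw [hslope_eq, norm_smul, Real.norm_of_nonneg hh.le]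
    gcongr
    exact (mem_ball_iff_norm.1 hz).le
  have hV0 := hP.minEnergy_nonneg (W t)
  have hy := hstep _ hx h ⟨hh.le, hhc.trans (min_le_left _ _)⟩
  have hδ1 : ‖δ‖ ≤ 1 := hδn.trans (mul_le_one₀ (hhc.trans (min_le_right _ _))
    (by positivity) (min_le_right _ _))
  have hyM : minEnergy P (W t + h • F (W t)) ≤ M := by
    nlinarith [mul_nonneg (mul_pos hc hh).le hV0]
  have hz' := hlip _ δ hyM hδ1
  rw [hδ, add_sub_cancel, ← hδ] at hz'
  rw [inv_mul_lt_iff₀ hh]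
  have h5 : C * ‖δ‖ ≤ C * (h * η) := by
    gcongr
    exact hδn.trans (by gcongr; exact min_le_left _ _)
  have h6 : C * η < r + c * minEnergy P (W t) := by
    have : (C + 1) * η = r + c * minEnergy P (W t) := by
      rw [hη]; field_simp
    linarith
  nlinarith [mul_lt_mul_of_pos_left h6 hh]

/-- A vector field that vanishes at the origin and strictly contracts a proper metric is
exponentially stable, uniformly on balls of initial conditions. -/
theorem IsProperMetric.exponential_stability [FiniteDimensional ℝ E] (hP : IsProperMetric P p)
    {q : ℝ → ℝ} (hq : MonotoneOn q (Ici 0))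
    (hup : ∀ w v : E, ⟪P w v, v⟫ ≤ q ‖w‖ * ‖v‖ ^ 2)
    {F : E → E} (hF : ContDiff ℝ 1 F) (hF0 : F 0 = 0)
    (hneg : ∀ w v : E, v ≠ 0 → ⟪fderiv ℝ P w (F w) v, v⟫ + ⟪P w (fderiv ℝ F w v), v⟫ +
      ⟪P w v, fderiv ℝ F w v⟫ < 0) {r : ℝ} (hr : 0 < r) :
    ∃ k μ : ℝ, 0 < k ∧ 0 < μ ∧ ∀ W : ℝ → E,
      (∀ t, 0 ≤ t → HasDerivWithinAt W (F (W t)) (Ici 0) t) →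
      ‖W 0‖ ≤ r → ∀ t, 0 ≤ t → ‖W t‖ ≤ k * exp (-μ * t) * ‖W 0‖ := by
  set b := max (q r) 1 with hb
  have hb0 : 0 < b := by positivity
  have hVup : ∀ x : E, ‖x‖ ≤ r → minEnergy P x ≤ b * ‖x‖ ^ 2 := fun x hx =>
    (hP.minEnergy_le_of_upper hq hup x).trans (mul_le_mul_of_nonneg_right
      ((hq (norm_nonneg x) hr.le hx).trans (le_max_left _ _)) (sq_nonneg _))
  obtain ⟨a, ha, hlow⟩ := hP.exists_mul_sq_norm_le_minEnergy (b * r ^ 2)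
  obtain ⟨c, hc, hstep⟩ := hP.exists_minEnergy_euler_le hF hF0 hneg (b * r ^ 2)
  refine ⟨√(b / a), c / 2, by positivity, half_pos hc, fun W hW hW0 t ht => ?_⟩
  have hWc : ContinuousOn W (Ici 0) := fun t ht => (hW t ht).continuousWithinAt
  have hinit : minEnergy P (W 0) ≤ b * r ^ 2 := (hVup _ hW0).trans (by gcongr)
  have hmono : ∀ T, 0 ≤ T → minEnergy P (W T) ≤ minEnergy P (W 0) := by
    intro T hT
    obtain ⟨M, hM⟩ := isCompact_Icc.exists_bound_of_continuousOn
      (hP.continuous_minEnergy.comp_continuousOn (s := Icc 0 T) (hWc.mono Icc_subset_Ici_self))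
    obtain ⟨c', hc', hstep'⟩ := hP.exists_minEnergy_euler_le hF hF0 hneg M
    refine (hP.minEnergy_le_exp hc' hstep' hW hT fun s hs =>
      (le_abs_self _).trans (hM s hs)).trans ?_
    refine mul_le_of_le_one_right (hP.minEnergy_nonneg _) (exp_le_one_iff.2 ?_)
    nlinarith
  have hdecay := hP.minEnergy_le_exp hc hstep hW ht fun s hs => (hmono s hs.1).trans hinit
  have h1 : a * ‖W t‖ ^ 2 ≤ b * ‖W 0‖ ^ 2 * exp (-c * t) :=
    ((hlow _ ((hmono t ht).trans hinit)).trans hdecay).trans (by gcongr; exact hVup _ hW0)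
  refine abs_le_of_sq_le_sq' ?_ (by positivity) |>.2
  have h2 : exp (-(c / 2) * t) ^ 2 = exp (-c * t) := by
    rw [← exp_nat_mul]; congr 1; push_cast; ring
  rw [mul_pow, mul_pow, h2, sq_sqrt (by positivity), div_mul_eq_mul_div, div_mul_eq_mul_div,
    le_div_iff₀ ha]
  linarith

end RiemannianStabilization

/-- **Stabilization** (Proposition 8): consider ẇ = f(w) + g(w)u with f, g smooth.
Assume there is a C³ symmetric metric P with p̲(|w|) I ≤ P(w) ≤ p̄(|w|) I,
p̲ positive non-increasing with p̲(r)r² → ∞, p̄ non-decreasing, such that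
(1) 𝔡_f P + P ∂f/∂w + ∂f/∂wᵀ P − λ P g gᵀ P ≤ −Q for some λ > 0 and some
symmetric positive definite Q, (2) g is a Killing vector field for P, and
(3) (∂U/∂w)(w) = (P(w)g(w))ᵀ for some C¹ function U; assume the origin is an
equilibrium of the closed loop F(w) = f(w) − λ g(w) U(w).  Then the closed loop
satisfies L_F P(w) ≤ −Q for all w and its origin is locally exponentially stable
and globally attractive.  (Since P is C¹, the derivative of P along a vector
field h is 𝔡_h P(w) = DP(w)·h(w).) -/
theorem stabilization_riemannian
    {n : ℕ}
    (f g : Euc n → Euc n) (hf : ContDiff ℝ (⊤ : ℕ∞) f) (hg : ContDiff ℝ (⊤ : ℕ∞) g)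
    (P : Euc n → Euc n →L[ℝ] Euc n) (hP : ContDiff ℝ 3 P)
    (hPsa : ∀ w, IsSelfAdjoint (P w))
    -- bounds and properness of the metric
    (pl pu : ℝ → ℝ)
    (hplpos : ∀ s, 0 ≤ s → 0 < pl s)
    (hpl : AntitoneOn pl (Ici 0)) (hpu : MonotoneOn pu (Ici 0))
    (hPbnd : ∀ w v : Euc n,
      pl ‖w‖ * ‖v‖ ^ 2 ≤ ⟪P w v, v⟫ ∧ ⟪P w v, v⟫ ≤ pu ‖w‖ * ‖v‖ ^ 2)
    (hproper : Tendsto (fun r => pl r * r ^ 2) atTop atTop)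
    -- (1) the Riccati-type matrix inequality
    (lam : ℝ) (hlam : 0 < lam)
    (Q : Euc n →L[ℝ] Euc n) (hQsa : IsSelfAdjoint Q)
    (hQpos : ∀ v, v ≠ 0 → 0 < ⟪Q v, v⟫)
    (hRiccati : ∀ w v : Euc n,
      ⟪(fderiv ℝ P w (f w) + P w ∘L fderiv ℝ f w +
          ContinuousLinearMap.adjoint (fderiv ℝ f w) ∘L P w) v, v⟫
        - lam * ⟪P w (g w), v⟫ ^ 2 ≤ -⟪Q v, v⟫)
    -- (2) g is a Killing vector field for the metric P
    (hKilling : ∀ w, fderiv ℝ P w (g w) + P w ∘L fderiv ℝ g w +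
        ContinuousLinearMap.adjoint (fderiv ℝ g w) ∘L P w = 0)
    -- (3) P g is a gradient field: ∂U/∂w = (P g)ᵀ
    (U : Euc n → ℝ) (hU : ContDiff ℝ 1 U)
    (hgrad : ∀ w v : Euc n, fderiv ℝ U w v = ⟪P w (g w), v⟫)
    -- the origin is an equilibrium of the closed loop F(w) = f(w) − λ g(w) U(w)
    (hF0 : f 0 - (lam * U 0) • g 0 = 0) :
    -- L_F P ≤ −Q for the closed-loop vector field F(w) = f(w) − λ g(w) U(w)
    (∀ w v : Euc n,
      ⟪(fderiv ℝ P w (f w - (lam * U w) • g w) +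
          P w ∘L fderiv ℝ (fun w' => f w' - (lam * U w') • g w') w +
          ContinuousLinearMap.adjoint
            (fderiv ℝ (fun w' => f w' - (lam * U w') • g w') w) ∘L P w) v, v⟫
        ≤ -⟪Q v, v⟫) ∧
    -- local exponential stability of the closed loop
    (∃ kk mu rr : ℝ, 0 < kk ∧ 0 < mu ∧ 0 < rr ∧
      ∀ (W : ℝ → Euc n),
        (∀ t, 0 ≤ t →
          HasDerivWithinAt W (f (W t) - (lam * U (W t)) • g (W t)) (Ici 0) t) →
        ‖W 0‖ ≤ rr → ∀ t, 0 ≤ t → ‖W t‖ ≤ kk * exp (-mu * t) * ‖W 0‖) ∧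
    -- global attractivity of the closed loop
    (∀ (W : ℝ → Euc n),
      (∀ t, 0 ≤ t →
        HasDerivWithinAt W (f (W t) - (lam * U (W t)) • g (W t)) (Ici 0) t) →
      Tendsto (fun t => ‖W t‖) atTop (𝓝 0)) := by
  have hF : ContDiff ℝ 1 fun w => f w - (lam * U w) • g w := by
    have hf1 : ContDiff ℝ 1 f := hf.of_le (by exact_mod_cast le_top)
    have hg1 : ContDiff ℝ 1 g := hg.of_le (by exact_mod_cast le_top)
    fun_prop
  have hDF : ∀ w v : Euc n, fderiv ℝ (fun w' => f w' - (lam * U w') • g w') w v =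
      fderiv ℝ f w v - (lam * U w) • fderiv ℝ g w v - (lam * ⟪P w (g w), v⟫) • g w := by
    intro w v
    have k1 := ((hf.differentiable (by simp)) w).hasFDerivAt
    have k2 := ((hg.differentiable (by simp)) w).hasFDerivAt
    have k3 := (((hU.differentiable one_ne_zero) w).hasFDerivAt.const_mul lam)
    have k := k1.sub (k3.smul k2)
    have e := congrArg (fun A : Euc n →L[ℝ] Euc n => A v) k.fderiv
    refine e.trans ?_
    simp [hgrad, sub_sub]
  have hLF : ∀ w v : Euc n,
      ⟪(fderiv ℝ P w (f w - (lam * U w) • g w) +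
          P w ∘L fderiv ℝ (fun w' => f w' - (lam * U w') • g w') w +
          ContinuousLinearMap.adjoint
            (fderiv ℝ (fun w' => f w' - (lam * U w') • g w') w) ∘L P w) v, v⟫
        ≤ -⟪Q v, v⟫ := by
    intro w v
    have hR := hRiccati w v
    have hK := congrArg (fun A : Euc n →L[ℝ] Euc n => ⟪A v, v⟫) (hKilling w)
    have hs : ⟪P w v, g w⟫ = ⟪P w (g w), v⟫ := by
      rw [real_inner_comm]
      exact ((hPsa w).isSymmetric (g w) v).symm
    simp only [_root_.add_apply, ContinuousLinearMap.comp_apply,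
      ContinuousLinearMap.adjoint_inner_left, inner_add_left, _root_.zero_apply,
      inner_zero_left] at hR hK ⊢
    simp only [hDF, map_sub, map_smul, _root_.sub_apply,
      _root_.smul_apply, inner_sub_left, inner_sub_right, inner_smul_left,
      inner_smul_right, conj_trivial, hs]
    have hsq : 0 ≤ lam * ⟪P w (g w), v⟫ ^ 2 := by positivity
    linear_combination hR - lam * U w * hK + hsq
  have hPM : RiemannianStabilization.IsProperMetric P pl :=
    ⟨hP.of_le (by norm_num), hplpos, hpl, fun w v => (hPbnd w v).1, hproper⟩
  have hneg : ∀ w v : Euc n, v ≠ 0 →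
      ⟪fderiv ℝ P w (f w - (lam * U w) • g w) v, v⟫ +
      ⟪P w (fderiv ℝ (fun w' => f w' - (lam * U w') • g w') w v), v⟫ +
      ⟪P w v, fderiv ℝ (fun w' => f w' - (lam * U w') • g w') w v⟫ < 0 := by
    intro w v hv
    have h := hLF w v
    simp only [_root_.add_apply, ContinuousLinearMap.comp_apply,
      ContinuousLinearMap.adjoint_inner_left, inner_add_left] at h
    linarith [hQpos v hv]
  have hstab := fun {r : ℝ} (hr : 0 < r) =>
    hPM.exponential_stability hpu (fun w v => (hPbnd w v).2) hF hF0 hneg hr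
  refine ⟨hLF, ?_, fun W hW => ?_⟩
  · obtain ⟨k, μ, hk, hμ, h⟩ := hstab one_pos
    exact ⟨k, μ, 1, hk, hμ, one_pos, h⟩
  · obtain ⟨k, μ, hk, hμ, h⟩ := hstab (show 0 < ‖W 0‖ + 1 by positivity)
    have hlim : Tendsto (fun t => k * exp (-μ * t) * ‖W 0‖) atTop (𝓝 0) := by
      have h1 : Tendsto (fun t => exp (-μ * t)) atTop (𝓝 0) :=
        tendsto_exp_atBot.comp (tendsto_id.const_mul_atTop_of_neg (neg_neg_of_pos hμ))
      simpa using (h1.const_mul k).mul_const ‖W 0‖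
    refine squeeze_zero' (Eventually.of_forall fun t => norm_nonneg _) ?_ hlim
    filter_upwards [eventually_ge_atTop 0] with t ht
    exact h W hW (by linarith) t ht
end
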